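/- Assume ν > −1/2. There exists a constant C such that for all t > 0 and x, y ∈ (0,1), |δ_L P_t(x,y)| ≤ C / (t² + |x−y|²), where δ_L P_t(x,y) = −∂P_t(x,y)/∂x + ((ν+1/2)/x) P_t(x,y). Equivalently, Σ_{n=1}^∞ e^{−t λ_{n,ν}} d_{n,ν}² λ_{n,ν}² (xy)^{1/2} J_{ν+1}(λ_{n,ν} x) J_ν(λ_{n,ν} y) is bounded in absolute value by C/(t²+|x−y|²). -/

import Mathlib

open MeasureTheory Real Set Filter Topology
open scoped ENNReal NNReal

/-- Bessel function of the first kind of order `ν` (defined by its power series). -/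
noncomputable def besselJ (ν x : ℝ) : ℝ :=
  ∑' m : ℕ, ((-1 : ℝ) ^ m / ((m.factorial : ℝ) * Real.Gamma ((m : ℝ) + ν + 1))) *
    (x / 2) ^ (2 * (m : ℝ) + ν)

/-- `Λ` enumerates the successive positive zeros of `J_ν`, in increasing order,
`Λ n` corresponding to `λ_{n+1,ν}`. -/
def IsPositiveZerosOfBesselJ (ν : ℝ) (Λ : ℕ → ℝ) : Prop :=
  StrictMono Λ ∧ (∀ n, 0 < Λ n) ∧ (∀ n, besselJ ν (Λ n) = 0) ∧
    ∀ x : ℝ, 0 < x → besselJ ν x = 0 → ∃ n, Λ n = x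

/-- The eigenfunctions `φ_n^ν`. -/
noncomputable def phiFB (ν : ℝ) (Λ : ℕ → ℝ) (n : ℕ) (x : ℝ) : ℝ :=
  (Real.sqrt 2 / |Λ n * besselJ (ν + 1) (Λ n)|) * Real.sqrt (Λ n) *
    besselJ ν (Λ n * x) * x ^ (-ν)

/-- The Fourier–Bessel Poisson kernel `𝒫_t(x,y)`. -/
noncomputable def pKer (ν : ℝ) (Λ : ℕ → ℝ) (t x y : ℝ) : ℝ :=
  ∑' n : ℕ, Real.exp (-t * Λ n) * phiFB ν Λ n x * phiFB ν Λ n y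

/-- The kernel `P_t(x,y) = (xy)^{ν+1/2} 𝒫_t(x,y)`. -/
noncomputable def pKerL (ν : ℝ) (Λ : ℕ → ℝ) (t x y : ℝ) : ℝ :=
  (x * y) ^ (ν + 1/2) * pKer ν Λ t x y

/-- The measure `dμ(x) = x^{2ν+1} dx` on `(0,1)`. -/
noncomputable def muMeas (ν : ℝ) : Measure ℝ :=
  (volume.restrict (Ioo 0 1)).withDensity fun x => ENNReal.ofReal (x ^ (2 * ν + 1))

noncomputable def pI (j : ℕ) : ℝ := 1 - (1/2 : ℝ) ^ j
noncomputable def qI (j : ℕ) : ℝ := 1 - (1/2 : ℝ) ^ (j + 1)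

/-- The `s`-dilate (same center, `s` times the length) of `(p,q]`, intersected with `(0,1)`. -/
def starSet (s p q : ℝ) : Set ℝ :=
  Ioc ((p + q)/2 - s * (q - p)/2) ((p + q)/2 + s * (q - p)/2) ∩ Ioo 0 1

noncomputable def Istar (j : ℕ) : Set ℝ := starSet (51/50) (pI j) (qI j)
noncomputable def Istar2 (j : ℕ) : Set ℝ := starSet ((51/50)^2) (pI j) (qI j)

noncomputable def pJ (j : ℤ) : ℝ := if 1 ≤ j then 1 - (2:ℝ) ^ (-j) else (2:ℝ) ^ (j - 1)
noncomputable def qJ (j : ℤ) : ℝ := if 1 ≤ j then 1 - (2:ℝ) ^ (-j - 1) else (2:ℝ) ^ j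

noncomputable def Jstar (j : ℤ) : Set ℝ := starSet (51/50) (pJ j) (qJ j)
noncomputable def Jstar2 (j : ℤ) : Set ℝ := starSet ((51/50)^2) (pJ j) (qJ j)

/-- Modified Bessel function of the first kind. -/
noncomputable def besselI (ν x : ℝ) : ℝ :=
  ∑' m : ℕ, (1 / ((m.factorial : ℝ) * Real.Gamma ((m : ℝ) + ν + 1))) *
    (x / 2) ^ (2 * (m : ℝ) + ν)

/-- The Bessel heat kernel `𝐓_t(x,y)` on `(0,∞)`. -/
noncomputable def bHeatKer (ν t x y : ℝ) : ℝ :=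
  (2*t)⁻¹ * Real.exp (-(x^2 + y^2)/(4*t)) * besselI ν (x*y/(2*t)) * (x*y) ^ (-ν)

/-- The Fourier–Bessel heat kernel `𝒯_t(x,y)` on `(0,1)`. -/
noncomputable def fbHeatKer (ν : ℝ) (Λ : ℕ → ℝ) (t x y : ℝ) : ℝ :=
  ∑' n : ℕ, Real.exp (-t * (Λ n)^2) * phiFB ν Λ n x * phiFB ν Λ n y

/-- The entire function `s ↦ ∑ (-1)^m s^m / (m! Γ(m+ν+1))`, for which
`J_ν(z) = (z/2)^ν besselEntire ν (z²/4)`. -/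
noncomputable def besselEntire (ν s : ℝ) : ℝ :=
  ∑' m : ℕ, ((-1 : ℝ) ^ m / ((m.factorial : ℝ) * Real.Gamma ((m : ℝ) + ν + 1))) * s ^ m

lemma gamma_add_nat_ge {ν : ℝ} (hν : -(1/2 : ℝ) < ν) (m : ℕ) :
    Real.Gamma (ν + 1) * (1/2) ^ m ≤ Real.Gamma ((m : ℝ) + ν + 1) := by
  induction m with
  | zero => simp
  | succ k ih =>
    have hk : (0 : ℝ) ≤ k := Nat.cast_nonneg k
    have h1 : Real.Gamma (((k + 1 : ℕ) : ℝ) + ν + 1)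
        = ((k : ℝ) + ν + 1) * Real.Gamma ((k : ℝ) + ν + 1) := by
      rw [← Real.Gamma_add_one (by linarith)]
      push_cast
      ring_nf
    have h2 : 0 < Real.Gamma ((k : ℝ) + ν + 1) := Real.Gamma_pos_of_pos (by linarith)
    rw [h1, pow_succ]
    nlinarith

lemma summable_besselEntire {ν : ℝ} (hν : -(1/2 : ℝ) < ν) (s : ℝ) :
    Summable fun m : ℕ =>
      ((-1 : ℝ) ^ m / ((m.factorial : ℝ) * Real.Gamma ((m : ℝ) + ν + 1))) * s ^ m := by
  have hG : 0 < Real.Gamma (ν + 1) := Real.Gamma_pos_of_pos (by linarith)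
  refine Summable.of_norm_bounded
    ((Real.summable_pow_div_factorial (2 * |s|)).mul_left (Real.Gamma (ν + 1))⁻¹) fun m => ?_
  have hf : (0 : ℝ) < m.factorial := by positivity
  have h := gamma_add_nat_ge hν m
  have hp : 0 < Real.Gamma (ν + 1) * (1/2) ^ m := by positivity
  rw [norm_mul, norm_div, norm_pow, norm_neg, norm_one, one_pow, norm_pow, Real.norm_eq_abs,
    Real.norm_eq_abs, abs_of_pos (mul_pos hf (hp.trans_le h))]
  calc 1 / ((m.factorial : ℝ) * Real.Gamma ((m : ℝ) + ν + 1)) * |s| ^ m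
      ≤ 1 / ((m.factorial : ℝ) * (Real.Gamma (ν + 1) * (1/2) ^ m)) * |s| ^ m := by gcongr
    _ = (Real.Gamma (ν + 1))⁻¹ * ((2 * |s|) ^ m / m.factorial) := by
      rw [mul_pow, one_div_pow]
      field_simp

lemma besselEntire_coeff_succ {ν : ℝ} (m : ℕ) :
    ((-1 : ℝ) ^ (m + 1) / (((m + 1).factorial : ℝ) * Real.Gamma (((m + 1 : ℕ) : ℝ) + ν + 1))) *
      ((m + 1 : ℕ) : ℝ)
      = -((-1 : ℝ) ^ m / ((m.factorial : ℝ) * Real.Gamma ((m : ℝ) + (ν + 1) + 1))) := by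
  have e : ((m + 1 : ℕ) : ℝ) + ν + 1 = (m : ℝ) + (ν + 1) + 1 := by push_cast; ring
  have hm : ((m + 1 : ℕ) : ℝ) ≠ 0 := by positivity
  rw [e, Nat.factorial_succ, Nat.cast_mul, pow_succ]
  field_simp

lemma hasDerivAt_besselEntire {ν : ℝ} (hν : -(1/2 : ℝ) < ν) (s : ℝ) :
    HasDerivAt (besselEntire ν) (-besselEntire (ν + 1) s) s := by
  set R : ℝ := |s| + 1 with hR
  set b : ℕ → ℝ := fun m => (-1 : ℝ) ^ m / ((m.factorial : ℝ) * Real.Gamma ((m : ℝ) + ν + 1))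
    with hb
  have hν1 : -(1/2 : ℝ) < ν + 1 := by linarith
  have key (r : ℝ) (m : ℕ) : b (m + 1) * (((m + 1 : ℕ) : ℝ) * r ^ (m + 1 - 1))
      = -(((-1 : ℝ) ^ m / ((m.factorial : ℝ) * Real.Gamma ((m : ℝ) + (ν + 1) + 1))) * r ^ m) := by
    rw [← mul_assoc, hb]
    simp only
    rw [besselEntire_coeff_succ, Nat.add_sub_cancel]
    ring
  have hsum (r : ℝ) : Summable fun m : ℕ => b m * ((m : ℝ) * r ^ (m - 1)) := by
    rw [← summable_nat_add_iff 1]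
    simp_rw [key]
    exact (summable_besselEntire hν1 r).neg
  have hmem : s ∈ Ioo (-R) R := by
    rw [mem_Ioo, ← abs_lt]
    linarith
  have h := hasDerivAt_tsum_of_isPreconnected (𝕜 := ℝ) (hsum R).norm isOpen_Ioo
    (convex_Ioo (-R) R).isPreconnected (g := fun m r => b m * r ^ m)
    (g' := fun m r => b m * ((m : ℝ) * r ^ (m - 1)))
    (fun m r _ => (hasDerivAt_pow m r).const_mul (b m))
    (fun m r hr => by
      rw [norm_mul, norm_mul, norm_mul, norm_mul, norm_pow, norm_pow]
      have h1 : ‖r‖ ≤ ‖R‖ := by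
        rw [Real.norm_eq_abs, Real.norm_eq_abs]
        exact (abs_lt.2 ⟨hr.1, hr.2⟩).le.trans (le_abs_self R)
      gcongr)
    hmem (summable_besselEntire hν s) hmem
  have e : ∑' m : ℕ, b m * ((m : ℝ) * s ^ (m - 1)) = -besselEntire (ν + 1) s := by
    rw [(hsum s).tsum_eq_zero_add]
    simp_rw [key]
    rw [tsum_neg]
    simp [besselEntire]
  rw [e] at h
  exact h

lemma besselEntire_recurrence {ν : ℝ} (hν : -(1/2 : ℝ) < ν) (s : ℝ) :
    (ν + 1) * besselEntire (ν + 1) s - s * besselEntire (ν + 2) s = besselEntire ν s := by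
  have hν1 : -(1/2 : ℝ) < ν + 1 := by linarith
  have hν2 : -(1/2 : ℝ) < ν + 2 := by linarith
  set a : ℕ → ℝ := fun m => (m : ℝ) *
    (((-1 : ℝ) ^ m / ((m.factorial : ℝ) * Real.Gamma ((m : ℝ) + (ν + 1) + 1))) * s ^ m) with ha
  have key (m : ℕ) : a (m + 1) = -s *
      (((-1 : ℝ) ^ m / ((m.factorial : ℝ) * Real.Gamma ((m : ℝ) + (ν + 2) + 1))) * s ^ m) := by
    have h := besselEntire_coeff_succ (ν := ν + 1) m
    rw [show ν + 1 + 1 = ν + 2 by ring] at h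
    rw [ha]
    linear_combination s ^ (m + 1) * h
  have hs : Summable a := by
    rw [← summable_nat_add_iff 1]
    simp_rw [key]
    exact (summable_besselEntire hν2 s).mul_left _
  have e : ∑' m, a m = -s * besselEntire (ν + 2) s := by
    rw [hs.tsum_eq_zero_add]
    simp_rw [key]
    rw [tsum_mul_left]
    simp [ha, besselEntire]
  have e2 : (ν + 1) * besselEntire (ν + 1) s - s * besselEntire (ν + 2) s
      = (ν + 1) * besselEntire (ν + 1) s + ∑' m, a m := by rw [e]; ring
  rw [e2, besselEntire, ← tsum_mul_left,
    ← ((summable_besselEntire hν1 s).mul_left (ν + 1)).tsum_add hs, besselEntire]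
  refine tsum_congr fun m => ?_
  have hm : (0 : ℝ) ≤ m := Nat.cast_nonneg m
  have hpos : 0 < (m : ℝ) + ν + 1 := by linarith
  have hG : 0 < Real.Gamma ((m : ℝ) + ν + 1) := Real.Gamma_pos_of_pos hpos
  rw [ha]
  simp only
  rw [show (m : ℝ) + (ν + 1) + 1 = ((m : ℝ) + ν + 1) + 1 by ring, Real.Gamma_add_one hpos.ne']
  field_simp
  ring

/-- `√z J_ν(z)`. -/
noncomputable def sqrtMulBesselJ (ν z : ℝ) : ℝ := √z * besselJ ν z

lemma sqrtMulBesselJ_eq (ν : ℝ) {z : ℝ} (hz : 0 < z) :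
    sqrtMulBesselJ ν z = (2 : ℝ) ^ (-ν) * z ^ (ν + 1/2) * besselEntire ν (z ^ 2 / 4) := by
  have h : besselJ ν z = (z / 2) ^ ν * besselEntire ν (z ^ 2 / 4) := by
    rw [besselJ, besselEntire, ← tsum_mul_left]
    refine tsum_congr fun m => ?_
    have hz2 : 0 < z / 2 := by positivity
    rw [Real.rpow_add hz2, show (2 * (m : ℝ)) = ((2 * m : ℕ) : ℝ) by push_cast; ring,
      Real.rpow_natCast, pow_mul, show (z / 2) ^ 2 = z ^ 2 / 4 by ring]
    ring
  rw [sqrtMulBesselJ, h, Real.sqrt_eq_rpow, Real.div_rpow hz.le zero_le_two,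
    Real.rpow_add hz, Real.rpow_neg zero_le_two]
  ring

lemma hasDerivAt_sqrtMulBesselJ {ν : ℝ} (hν : -(1/2 : ℝ) < ν) {z : ℝ} (hz : 0 < z) :
    HasDerivAt (sqrtMulBesselJ ν)
      ((ν + 1/2) / z * sqrtMulBesselJ ν z - sqrtMulBesselJ (ν + 1) z) z := by
  have h1 : HasDerivAt (fun z : ℝ => z ^ 2 / 4) (z / 2) z := by
    have := (hasDerivAt_pow 2 z).div_const 4
    refine this.congr_deriv ?_
    push_cast
    ring
  have h2 := (hasDerivAt_besselEntire hν (z ^ 2 / 4)).comp z h1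
  have h3 := ((Real.hasDerivAt_rpow_const (p := ν + 1/2) (Or.inl hz.ne')).const_mul
    ((2 : ℝ) ^ (-ν))).mul h2
  have h4 := h3.congr_of_eventuallyEq (f₁ := sqrtMulBesselJ ν) (by
    filter_upwards [lt_mem_nhds hz] with w hw
    exact sqrtMulBesselJ_eq ν hw)
  refine h4.congr_deriv ?_
  rw [sqrtMulBesselJ_eq ν hz, sqrtMulBesselJ_eq (ν + 1) hz, Real.rpow_sub_one hz.ne',
    show ν + 1 + 1 / 2 = (ν + 1/2) + 1 by ring, Real.rpow_add_one hz.ne',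
    show -(ν + 1) = -ν - 1 by ring, Real.rpow_sub_one two_ne_zero]
  simp only [Function.comp]
  field_simp
  ring

lemma hasDerivAt_sqrtMulBesselJ_succ {ν : ℝ} (hν : -(1/2 : ℝ) < ν) {z : ℝ} (hz : 0 < z) :
    HasDerivAt (sqrtMulBesselJ (ν + 1))
      (sqrtMulBesselJ ν z - (ν + 1/2) / z * sqrtMulBesselJ (ν + 1) z) z := by
  have h := hasDerivAt_sqrtMulBesselJ (ν := ν + 1) (by linarith) hz
  refine h.congr_deriv ?_
  have hr := besselEntire_recurrence hν (z ^ 2 / 4)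
  rw [sqrtMulBesselJ_eq ν hz, sqrtMulBesselJ_eq (ν + 1) hz, sqrtMulBesselJ_eq (ν + 1 + 1) hz,
    ← hr, show ν + 1 + 1 + 1 / 2 = (ν + 1/2) + 1 + 1 by ring,
    show ν + 1 + 1 / 2 = (ν + 1/2) + 1 by ring,
    Real.rpow_add_one hz.ne' (ν + 1/2 + 1), Real.rpow_add_one hz.ne' (ν + 1/2),
    show -(ν + 1 + 1) = -ν - 1 - 1 by ring, show -(ν + 1) = -ν - 1 by ring,
    Real.rpow_sub_one two_ne_zero (-ν - 1), Real.rpow_sub_one two_ne_zero (-ν),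
    show ν + 1 + 1 = ν + 2 by ring]
  field_simp
  ring

lemma exists_abs_sqrtMulBesselJ_le {ν : ℝ} (hν : -(1/2 : ℝ) < ν) :
    ∃ C : ℝ, ∀ z, 0 < z → z ≤ 1 → |sqrtMulBesselJ ν z| ≤ C * z ^ (ν + 1/2) := by
  have hc : Continuous (besselEntire ν) :=
    continuous_iff_continuousAt.2 fun s => (hasDerivAt_besselEntire hν s).continuousAt
  obtain ⟨C, hC⟩ := (isCompact_Icc (a := (0 : ℝ)) (b := 1)).exists_bound_of_continuousOn
    hc.continuousOn
  refine ⟨(2 : ℝ) ^ (-ν) * C, fun z hz hz1 => ?_⟩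
  have h := hC (z ^ 2 / 4) ⟨by positivity, by nlinarith⟩
  rw [Real.norm_eq_abs] at h
  have h2 : (0 : ℝ) < 2 ^ (-ν) := by positivity
  have h3 : (0 : ℝ) < z ^ (ν + 1/2) := by positivity
  rw [sqrtMulBesselJ_eq ν hz, abs_mul, abs_mul, abs_of_pos h2, abs_of_pos h3]
  calc _ ≤ (2 : ℝ) ^ (-ν) * z ^ (ν + 1/2) * C := by gcongr
    _ = _ := by ring

/-- `f` is the real part of `e^{iz} W(z)` on the positive half-line, where `W` is bounded and
of bounded variation. -/
def HasBVAmplitude (M : ℝ) (f : ℝ → ℝ) : Prop :=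
  ∃ (W : ℝ → ℂ) (V : ℝ → ℝ),
    (∀ z, 0 < z → f z = (Complex.exp (z * Complex.I) * W z).re) ∧
    (∀ z, 0 < z → ‖W z‖ ≤ M) ∧ (∀ z, 0 < z → |V z| ≤ M) ∧
    ∀ a b, 0 < a → a ≤ b → ‖W b - W a‖ ≤ V b - V a

lemma norm_sub_le_sub_of_norm_deriv_le {W W' : ℝ → ℂ} {V V' : ℝ → ℝ} {a b : ℝ} (hab : a ≤ b)
    (hW : ∀ z ∈ Icc a b, HasDerivAt W (W' z) z) (hV : ∀ z ∈ Icc a b, HasDerivAt V (V' z) z)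
    (h : ∀ z ∈ Icc a b, ‖W' z‖ ≤ V' z) : ‖W b - W a‖ ≤ V b - V a := by
  refine image_norm_le_of_norm_deriv_right_le_deriv_boundary' (a := a) (b := b)
    (f := fun z => W z - W a) (f' := W') (B := fun z => V z - V a) (B' := V')
    ?_ ?_ ?_ ?_ ?_ ?_ ⟨hab, le_rfl⟩
  · exact fun z hz => ((hW z hz).sub_const _).continuousAt.continuousWithinAt
  · exact fun z hz => ((hW z (Ico_subset_Icc_self hz)).sub_const _).hasDerivWithinAt
  · simp
  · exact fun z hz => ((hV z hz).sub_const _).continuousAt.continuousWithinAt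
  · exact fun z hz => ((hV z (Ico_subset_Icc_self hz)).sub_const _).hasDerivWithinAt
  · exact fun z hz => h z (Ico_subset_Icc_self hz)

/-- `f` solves the normal form of the Bessel equation, with potential `1 - c / z²`, on the
positive half-line, and the second function is its derivative. -/
structure SolvesBesselODE (c : ℝ) (f f' : ℝ → ℝ) : Prop where
  deriv_fst : ∀ z, 0 < z → HasDerivAt f (f' z) z
  deriv_snd : ∀ z, 0 < z → HasDerivAt f' (-f z + c / z ^ 2 * f z) z

namespace SolvesBesselODE

variable {c : ℝ} {f f' : ℝ → ℝ}

lemma hasDerivAt_energy_mul_exp (hf : SolvesBesselODE c f f') (k : ℝ) {z : ℝ} (hz : 0 < z) :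
    HasDerivAt (fun z => (f z ^ 2 + f' z ^ 2) * Real.exp (k / z))
      ((2 * c * (f z * f' z) - k * (f z ^ 2 + f' z ^ 2)) / z ^ 2 * Real.exp (k / z)) z := by
  have h1 := ((hf.deriv_fst z hz).pow 2).add ((hf.deriv_snd z hz).pow 2)
  have h2 : HasDerivAt (fun z : ℝ => k / z) (-k / z ^ 2) z := by
    refine ((hasDerivAt_inv hz.ne').const_mul k).congr_deriv ?_
    ring
  refine (h1.mul h2.exp).congr_deriv ?_
  simp only [Pi.add_apply, Pi.pow_apply]
  field_simp
  ring

lemma two_mul_mul_le (c x y : ℝ) : |2 * c * (x * y)| ≤ |c| * (x ^ 2 + y ^ 2) := by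
  rw [abs_mul, abs_mul, abs_mul, abs_two]
  have h : 2 * (|x| * |y|) ≤ x ^ 2 + y ^ 2 := by
    nlinarith [sq_nonneg (|x| - |y|), sq_abs x, sq_abs y]
  calc 2 * |c| * (|x| * |y|) = |c| * (2 * (|x| * |y|)) := by ring
    _ ≤ _ := by gcongr

lemma antitoneOn_energy (hf : SolvesBesselODE c f f') :
    AntitoneOn (fun z => (f z ^ 2 + f' z ^ 2) * Real.exp (|c| / z)) (Ioi 0) := by
  refine antitoneOn_of_hasDerivWithinAt_nonpos (convex_Ioi 0)
    (fun z hz => (hf.hasDerivAt_energy_mul_exp _ hz).continuousAt.continuousWithinAt)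
    (fun z hz => (hf.hasDerivAt_energy_mul_exp _
      (by simpa using hz)).hasDerivWithinAt) fun z _ => ?_
  refine mul_nonpos_of_nonpos_of_nonneg (div_nonpos_of_nonpos_of_nonneg ?_ (by positivity))
    (by positivity)
  linarith [le_abs_self (2 * c * (f z * f' z)), two_mul_mul_le c (f z) (f' z)]

lemma monotoneOn_energy (hf : SolvesBesselODE c f f') :
    MonotoneOn (fun z => (f z ^ 2 + f' z ^ 2) * Real.exp (-|c| / z)) (Ioi 0) := by
  refine monotoneOn_of_hasDerivWithinAt_nonneg (convex_Ioi 0)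
    (fun z hz => (hf.hasDerivAt_energy_mul_exp _ hz).continuousAt.continuousWithinAt)
    (fun z hz => (hf.hasDerivAt_energy_mul_exp _
      (by simpa using hz)).hasDerivWithinAt) fun z _ => ?_
  refine mul_nonneg (div_nonneg ?_ (by positivity)) (by positivity)
  linarith [neg_abs_le (2 * c * (f z * f' z)), two_mul_mul_le c (f z) (f' z)]

lemma exists_bound (hf : SolvesBesselODE c f f') {a : ℝ} (ha : 0 < a) :
    ∃ D : ℝ, 0 < D ∧ ∀ z, a ≤ z → |f z| ≤ D ∧ |f' z| ≤ D := by
  set E : ℝ := (f a ^ 2 + f' a ^ 2) * Real.exp (|c| / a) with hE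
  have hE0 : 0 ≤ E := by positivity
  refine ⟨E + 1, by linarith, fun z hz => ?_⟩
  have hz0 : 0 < z := ha.trans_le hz
  have h1 := hf.antitoneOn_energy (mem_Ioi.2 ha) (mem_Ioi.2 hz0) hz
  simp only at h1
  have h2 : 1 ≤ Real.exp (|c| / z) := Real.one_le_exp (by positivity)
  have h3 : f z ^ 2 + f' z ^ 2 ≤ E := by nlinarith [sq_nonneg (f' z), sq_nonneg (f z)]
  constructor
  · apply abs_le_of_sq_le_sq _ (by linarith)
    nlinarith [sq_nonneg (f' z)]
  · apply abs_le_of_sq_le_sq _ (by linarith)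
    nlinarith [sq_nonneg (f z)]

lemma eq_zero_of_eq_zero (hf : SolvesBesselODE c f f') {a : ℝ} (ha : 0 < a) (h0 : f a = 0)
    (h1 : f' a = 0) {z : ℝ} (hz : 0 < z) (hza : z ≤ a) : f z = 0 := by
  have h := hf.monotoneOn_energy (mem_Ioi.2 hz) (mem_Ioi.2 ha) hza
  simp only [h0, h1] at h
  have h2 : 0 < Real.exp (-|c| / z) := Real.exp_pos _
  have h3 : f z ^ 2 ≤ 0 := by
    by_contra! hcon
    have : 0 < (f z ^ 2 + f' z ^ 2) * Real.exp (-|c| / z) := by positivity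
    norm_num at h
    linarith
  exact pow_eq_zero_iff two_ne_zero |>.1 (le_antisymm h3 (sq_nonneg _))

lemma exists_energy_ge (hf : SolvesBesselODE c f f') {a : ℝ} (ha : 0 < a) (h : f' a ≠ 0) :
    ∃ e : ℝ, 0 < e ∧ ∀ z, a ≤ z → e ^ 2 ≤ f z ^ 2 + f' z ^ 2 := by
  set E : ℝ := (f a ^ 2 + f' a ^ 2) * Real.exp (-|c| / a) with hE
  have hE0 : 0 < E := by positivity
  refine ⟨√E, Real.sqrt_pos.2 hE0, fun z hz => ?_⟩
  have hz0 : 0 < z := ha.trans_le hz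
  have h1 := hf.monotoneOn_energy (mem_Ioi.2 ha) (mem_Ioi.2 hz0) hz
  simp only at h1
  have h2 : Real.exp (-|c| / z) ≤ 1 := by
    rw [Real.exp_le_one_iff]
    exact div_nonpos_of_nonpos_of_nonneg (by simp) hz0.le
  rw [Real.sq_sqrt hE0.le]
  nlinarith [sq_nonneg (f' z), sq_nonneg (f z)]

/-- The complex amplitude of the pair of a solution and its derivative at `z`. -/
noncomputable def amplitude (f f' : ℝ → ℝ) (z : ℝ) : ℂ :=
  Complex.exp (-(z * Complex.I)) * (f z - Complex.I * f' z)

lemma hasDerivAt_exp_neg_mul_I (z : ℝ) :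
    HasDerivAt (fun z : ℝ => Complex.exp (-(z * Complex.I)))
      (-Complex.I * Complex.exp (-(z * Complex.I))) z := by
  have h := ((Complex.ofRealCLM.hasDerivAt (x := z)).mul_const Complex.I).neg.cexp
  refine h.congr_deriv ?_
  simp
  ring

lemma norm_exp_neg_mul_I (z : ℝ) : ‖Complex.exp (-(z * Complex.I))‖ = 1 := by
  rw [← neg_mul, ← Complex.ofReal_neg, Complex.norm_exp_ofReal_mul_I]

lemma norm_amplitude (f f' : ℝ → ℝ) (z : ℝ) : ‖amplitude f f' z‖ ^ 2 = f z ^ 2 + f' z ^ 2 := by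
  rw [amplitude, norm_mul, norm_exp_neg_mul_I, one_mul, ← Complex.normSq_eq_norm_sq,
    Complex.normSq_apply]
  simp
  ring

lemma hasDerivAt_amplitude (hf : SolvesBesselODE c f f') {z : ℝ} (hz : 0 < z) :
    HasDerivAt (amplitude f f')
      (Complex.exp (-(z * Complex.I)) * (-Complex.I * ((c / z ^ 2 * f z : ℝ) : ℂ))) z := by
  have h := (hasDerivAt_exp_neg_mul_I z).mul
    ((hf.deriv_fst z hz).ofReal_comp.sub ((hf.deriv_snd z hz).ofReal_comp.const_mul Complex.I))
  refine h.congr_deriv ?_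
  simp only [Pi.sub_apply]
  push_cast
  linear_combination Complex.exp (-(z * Complex.I)) * (f' z : ℂ) * Complex.I_sq

lemma exists_norm_amplitude_sub_le (hf : SolvesBesselODE c f f') {a : ℝ} (ha : 0 < a) :
    ∃ A : ℝ, 0 < A ∧ ∀ y z, a ≤ y → y ≤ z →
      ‖amplitude f f' z - amplitude f f' y‖ ≤ A * (1 / y - 1 / z) := by
  obtain ⟨D, hD0, hD⟩ := hf.exists_bound ha
  refine ⟨|c| * D + 1, by positivity, fun y z hy hyz => ?_⟩
  have h := norm_sub_le_sub_of_norm_deriv_le (W := amplitude f f')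
    (V := fun z => -(|c| * D + 1) * z⁻¹) (V' := fun z => (|c| * D + 1) / z ^ 2) hyz
    (fun w hw => hf.hasDerivAt_amplitude (by linarith [hw.1]))
    (fun w hw => ((hasDerivAt_inv (by linarith [hw.1] : w ≠ 0)).const_mul _).congr_deriv
      (by ring)) fun w hw => ?_
  · refine h.trans (le_of_eq ?_)
    simp only [one_div]
    ring
  · rw [norm_mul, norm_exp_neg_mul_I, one_mul, norm_mul, norm_neg, Complex.norm_I, one_mul,
      Complex.norm_real, Real.norm_eq_abs, abs_mul, abs_div, abs_of_nonneg (sq_nonneg w)]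
    have h1 := (hD w (by linarith [hw.1])).1
    calc |c| / w ^ 2 * |f w| ≤ |c| / w ^ 2 * D := by gcongr
      _ = |c| * D / w ^ 2 := by ring
      _ ≤ _ := by gcongr; linarith

/-- A solution bounded near `0`, with derivative `O(z^{κ-1})` there, is the real part of
`e^{iz} W(z)` with `W` bounded and of bounded variation on the whole positive half-line. -/
lemma exists_hasBVAmplitude (hf : SolvesBesselODE c f f') {κ C : ℝ} (hκ : 0 < κ)
    (h0 : ∀ z, 0 < z → z ≤ 1 → |f z| ≤ C)
    (h1 : ∀ z, 0 < z → z ≤ 1 → |f' z| ≤ C * (z ^ (κ - 1) + 1)) :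
    ∃ M : ℝ, HasBVAmplitude M f := by
  obtain ⟨D, hD0, hD⟩ := hf.exists_bound one_pos
  have hC0 : 0 ≤ C := (abs_nonneg _).trans (h0 1 one_pos le_rfl)
  set χ : ℝ → ℝ := fun z => z ^ 2 / (1 + z ^ 2) with hχ
  set W : ℝ → ℂ := fun z => Complex.exp (-(z * Complex.I)) *
    (f z - Complex.I * ((χ z * f' z : ℝ) : ℂ)) with hW
  set B : ℝ := (3 + |c|) * (C + D) + 8 * C / κ + 2 * C with hB
  have hB0 : 0 < B := by positivity
  set V : ℝ → ℝ := fun z => B * (Real.arctan z - (1 + z ^ κ)⁻¹) with hV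
  have hχ' (z : ℝ) : HasDerivAt χ (2 * z / (1 + z ^ 2) ^ 2) z := by
    have hne : 1 + z ^ 2 ≠ 0 := by positivity
    refine ((hasDerivAt_pow 2 z).div ((hasDerivAt_pow 2 z).const_add 1) hne).congr_deriv ?_
    field_simp
    push_cast
    ring
  have hW' (z : ℝ) (hz : 0 < z) : HasDerivAt W (Complex.exp (-(z * Complex.I)) *
      (((f' z / (1 + z ^ 2) : ℝ) : ℂ) - Complex.I *
        (((1 + c) * f z / (1 + z ^ 2) + 2 * z * f' z / (1 + z ^ 2) ^ 2 : ℝ) : ℂ))) z := by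
    have h := (hasDerivAt_exp_neg_mul_I z).mul ((hf.deriv_fst z hz).ofReal_comp.sub
      (((hχ' z).mul (hf.deriv_snd z hz)).ofReal_comp.const_mul Complex.I))
    refine h.congr_deriv ?_
    have e1 : f' z / (1 + z ^ 2) = f' z - χ z * f' z := by
      rw [hχ]
      have hne : 1 + z ^ 2 ≠ 0 := by positivity
      field_simp
      ring
    have e2 : (1 + c) * f z / (1 + z ^ 2) + 2 * z * f' z / (1 + z ^ 2) ^ 2
        = f z + 2 * z / (1 + z ^ 2) ^ 2 * f' z + χ z * (-f z + c / z ^ 2 * f z) := by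
      rw [hχ]
      have hne : 1 + z ^ 2 ≠ 0 := by positivity
      field_simp
      ring
    rw [e1, e2]
    simp only [Pi.sub_apply, Pi.mul_apply]
    push_cast
    linear_combination Complex.exp (-(z * Complex.I)) * (χ z : ℂ) * (f' z : ℂ) * Complex.I_sq
  have hV' (z : ℝ) (hz : 0 < z) : HasDerivAt V
      (B * (1 / (1 + z ^ 2) + κ * z ^ (κ - 1) / (1 + z ^ κ) ^ 2)) z := by
    have hne : 1 + z ^ κ ≠ 0 := by positivity
    have h := ((Real.hasDerivAt_arctan z).sub
      (((Real.hasDerivAt_rpow_const (p := κ) (Or.inl hz.ne')).const_add 1).inv hne)).const_mul B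
    refine h.congr_deriv ?_
    ring
  have hle (z : ℝ) (hz : 0 < z) : ‖Complex.exp (-(z * Complex.I)) *
      (((f' z / (1 + z ^ 2) : ℝ) : ℂ) - Complex.I *
        (((1 + c) * f z / (1 + z ^ 2) + 2 * z * f' z / (1 + z ^ 2) ^ 2 : ℝ) : ℂ))‖
      ≤ B * (1 / (1 + z ^ 2) + κ * z ^ (κ - 1) / (1 + z ^ κ) ^ 2) := by
    have hpos : 0 < 1 + z ^ 2 := by positivity
    have hfirst : ‖Complex.exp (-(z * Complex.I)) *
      (((f' z / (1 + z ^ 2) : ℝ) : ℂ) - Complex.I *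
        (((1 + c) * f z / (1 + z ^ 2) + 2 * z * f' z / (1 + z ^ 2) ^ 2 : ℝ) : ℂ))‖
        ≤ ((1 + |c|) * |f z| + 2 * |f' z|) / (1 + z ^ 2) := by
      rw [norm_mul, norm_exp_neg_mul_I, one_mul]
      refine (norm_sub_le _ _).trans ?_
      rw [norm_mul, Complex.norm_I, one_mul, Complex.norm_real, Complex.norm_real,
        Real.norm_eq_abs, Real.norm_eq_abs]
      have ha : |f' z / (1 + z ^ 2)| = |f' z| / (1 + z ^ 2) := by rw [abs_div, abs_of_pos hpos]
      have hb : |(1 + c) * f z / (1 + z ^ 2)| ≤ (1 + |c|) * |f z| / (1 + z ^ 2) := by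
        rw [abs_div, abs_of_pos hpos, abs_mul]
        gcongr
        exact (abs_add_le _ _).trans (by rw [abs_one])
      have hd : |2 * z * f' z / (1 + z ^ 2) ^ 2| ≤ |f' z| / (1 + z ^ 2) := by
        rw [abs_div, abs_mul, abs_of_pos (by positivity : 0 < 2 * z),
          abs_of_pos (by positivity : 0 < (1 + z ^ 2) ^ 2), div_le_div_iff₀ (by positivity) hpos]
        nlinarith [mul_nonneg (mul_nonneg (abs_nonneg (f' z)) hpos.le) (sq_nonneg (z - 1))]
      calc _ ≤ |f' z| / (1 + z ^ 2)
            + ((1 + |c|) * |f z| / (1 + z ^ 2) + |f' z| / (1 + z ^ 2)) :=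
            add_le_add ha.le ((abs_add_le _ _).trans (add_le_add hb hd))
        _ = _ := by ring
    refine hfirst.trans ?_
    have hzκ : 0 < z ^ (κ - 1) := by positivity
    rcases le_total z 1 with hz1 | hz1
    · have hk1 : z ^ κ ≤ 1 := Real.rpow_le_one hz.le hz1 hκ.le
      have hk0 : 0 < z ^ κ := by positivity
      have hstep : z ^ (κ - 1) / 4 ≤ z ^ (κ - 1) / (1 + z ^ κ) ^ 2 := by
        gcongr
        nlinarith
      calc ((1 + |c|) * |f z| + 2 * |f' z|) / (1 + z ^ 2)
          ≤ ((1 + |c|) * C + 2 * (C * (z ^ (κ - 1) + 1))) / (1 + z ^ 2) := by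
            gcongr
            exacts [h0 z hz hz1, h1 z hz hz1]
        _ = ((3 + |c|) * C) * (1 / (1 + z ^ 2)) + 2 * C * z ^ (κ - 1) / (1 + z ^ 2) := by ring
        _ ≤ ((3 + |c|) * C) * (1 / (1 + z ^ 2)) + 2 * C * z ^ (κ - 1) := by
            gcongr
            exact div_le_self (by positivity) (by nlinarith)
        _ = ((3 + |c|) * C) * (1 / (1 + z ^ 2)) + (8 * C / κ) * κ * (z ^ (κ - 1) / 4) := by
            field_simp
            ring
        _ ≤ B * (1 / (1 + z ^ 2)) + B * κ * (z ^ (κ - 1) / (1 + z ^ κ) ^ 2) := by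
            have hcD : 0 ≤ (3 + |c|) * D := by positivity
            have hc8 : 0 ≤ 8 * C / κ := by positivity
            have hcC : 0 ≤ (3 + |c|) * C := by positivity
            gcongr <;> rw [hB] <;> linarith
        _ = _ := by ring
    · obtain ⟨hd0, hd1⟩ := hD z hz1
      calc ((1 + |c|) * |f z| + 2 * |f' z|) / (1 + z ^ 2)
          ≤ ((1 + |c|) * D + 2 * D) / (1 + z ^ 2) := by gcongr
        _ = ((3 + |c|) * D) * (1 / (1 + z ^ 2)) := by ring
        _ ≤ B * (1 / (1 + z ^ 2)) := by
            have hc8 : 0 ≤ 8 * C / κ := by positivity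
            have hcC : 0 ≤ (3 + |c|) * C := by positivity
            gcongr
            rw [hB]
            linarith
        _ ≤ _ := by
            gcongr
            have : 0 ≤ κ * z ^ (κ - 1) / (1 + z ^ κ) ^ 2 := by positivity
            linarith
  have hVb (z : ℝ) (hz : 0 < z) : |V z| ≤ 3 * B := by
    have hk0 : 0 < z ^ κ := by positivity
    have hi : (1 + z ^ κ)⁻¹ ≤ 1 := inv_le_one_of_one_le₀ (by linarith)
    have hi0 : 0 < (1 + z ^ κ)⁻¹ := by positivity
    have ht := Real.arctan_lt_pi_div_two z
    have ht0 := Real.neg_pi_div_two_lt_arctan z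
    have hp := Real.pi_lt_four
    rw [hV, abs_mul, abs_of_pos hB0, mul_comm]
    gcongr
    rw [abs_le]
    constructor <;> linarith
  have hvar (a b : ℝ) (ha : 0 < a) (hab : a ≤ b) : ‖W b - W a‖ ≤ V b - V a :=
    norm_sub_le_sub_of_norm_deriv_le hab (fun z hz => hW' z (ha.trans_le hz.1))
      (fun z hz => hV' z (ha.trans_le hz.1)) fun z hz => hle z (ha.trans_le hz.1)
  refine ⟨6 * B + ‖W 1‖, W, V, fun z hz => ?_, fun z hz => ?_, fun z hz => ?_,
    hvar⟩
  · rw [hW]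
    simp only
    rw [← mul_assoc, ← Complex.exp_add, add_neg_cancel, Complex.exp_zero, one_mul]
    simp
  · have hz' := abs_le.1 (hVb z hz)
    have h1' := abs_le.1 (hVb 1 one_pos)
    have h2 : ‖W z - W 1‖ ≤ 6 * B := by
      rcases le_total z 1 with hz1 | hz1
      · rw [norm_sub_rev]
        linarith [hvar z 1 hz hz1]
      · linarith [hvar 1 z one_pos hz1]
    have h3 : ‖W z‖ ≤ ‖W z - W 1‖ + ‖W 1‖ := by
      simpa using norm_add_le (W z - W 1) (W 1)
    linarith
  · linarith [hVb z hz, norm_nonneg (W 1)]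

end SolvesBesselODE

/-- `Λ` enumerates the positive zeros of `f` in increasing order. -/
structure EnumeratesPositiveZeros (f : ℝ → ℝ) (Λ : ℕ → ℝ) : Prop where
  strictMono : StrictMono Λ
  pos : ∀ n, 0 < Λ n
  eq_zero : ∀ n, f (Λ n) = 0
  exists_eq : ∀ z, 0 < z → f z = 0 → ∃ n, Λ n = z

namespace SolvesBesselODE

variable {c : ℝ} {f f' : ℝ → ℝ} {Λ : ℕ → ℝ}

lemma abs_sub_sin_mul_le {w : ℝ} (hw : f w = 0) (z : ℝ) :
    |f z - Real.sin (z - w) * f' w| ≤ ‖amplitude f f' z - amplitude f f' w‖ := by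
  have h1 : ‖Complex.exp (z * Complex.I)‖ = 1 := Complex.norm_exp_ofReal_mul_I z
  have h2 : Complex.exp (z * Complex.I) * (amplitude f f' z - amplitude f f' w)
      = f z - Complex.I * f' z + Complex.I * Complex.exp (((z - w : ℝ) : ℂ) * Complex.I) * f' w := by
    rw [amplitude, amplitude, hw, mul_sub, ← mul_assoc, ← mul_assoc, ← Complex.exp_add,
      ← Complex.exp_add, add_neg_cancel, Complex.exp_zero]
    have e : (z : ℂ) * Complex.I + -(w * Complex.I) = ((z - w : ℝ) : ℂ) * Complex.I := by
      push_cast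
      ring
    rw [e]
    push_cast
    ring
  have h3 : (Complex.exp (z * Complex.I) * (amplitude f f' z - amplitude f f' w)).re
      = f z - Real.sin (z - w) * f' w := by
    rw [h2]
    simp [Complex.exp_ofReal_mul_I_im, Complex.exp_ofReal_mul_I_re, -Complex.ofReal_sub]
    ring
  rw [← h3]
  refine (Complex.abs_re_le_norm _).trans ?_
  rw [norm_mul, h1, one_mul]

lemma exists_abs_deriv_zero_ge (hf : SolvesBesselODE c f f') (hΛ : EnumeratesPositiveZeros f Λ) :
    ∃ e : ℝ, 0 < e ∧ ∀ n, e ≤ |f' (Λ n)| := by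
  have h0 : f' (Λ 0) ≠ 0 := by
    intro h
    have hp := hΛ.pos 0
    obtain ⟨n, hn⟩ := hΛ.exists_eq (Λ 0 / 2) (by linarith)
      (hf.eq_zero_of_eq_zero hp (hΛ.eq_zero 0) h (by linarith) (by linarith))
    have := hΛ.strictMono.monotone (Nat.zero_le n)
    linarith
  obtain ⟨e, he, h⟩ := hf.exists_energy_ge (hΛ.pos 0) h0
  refine ⟨e, he, fun n => ?_⟩
  have h1 := h (Λ n) (hΛ.strictMono.monotone (Nat.zero_le n))
  rw [hΛ.eq_zero n] at h1
  have h2 : e ^ 2 ≤ f' (Λ n) ^ 2 := by linarith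
  rw [sq_le_sq, abs_of_pos he] at h2
  exact h2

lemma exists_mul_le_zero (hf : SolvesBesselODE c f f') (hΛ : EnumeratesPositiveZeros f Λ) :
    ∃ s : ℝ, 0 < s ∧ ∀ n : ℕ, s * (n + 1) ≤ Λ n := by
  obtain ⟨e, he, hge⟩ := hf.exists_abs_deriv_zero_ge hΛ
  obtain ⟨D, hD0, hD⟩ := hf.exists_bound (hΛ.pos 0)
  have hp := hΛ.pos 0
  set Q : ℝ := (1 + |c| / Λ 0 ^ 2) * D with hQ
  have hQ0 : 0 < Q := by positivity
  have hgap (n : ℕ) : e / Q ≤ Λ (n + 1) - Λ n := by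
    have hlt : Λ n < Λ (n + 1) := hΛ.strictMono (Nat.lt_succ_self n)
    have h0n : Λ 0 ≤ Λ n := hΛ.strictMono.monotone (Nat.zero_le n)
    obtain ⟨m, hm, hm0⟩ := exists_hasDerivAt_eq_zero hlt
      (fun z hz => (hf.deriv_fst z (by linarith [hz.1])).continuousAt.continuousWithinAt)
      ((hΛ.eq_zero n).trans (hΛ.eq_zero (n + 1)).symm)
      (fun z hz => hf.deriv_fst z (by linarith [hz.1]))
    obtain ⟨k, hk, hk0⟩ := exists_hasDerivAt_eq_slope f' (fun z => -f z + c / z ^ 2 * f z) hm.1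
      (fun z hz => (hf.deriv_snd z (by linarith [hz.1])).continuousAt.continuousWithinAt)
      (fun z hz => hf.deriv_snd z (by linarith [hz.1]))
    have hkΛ : Λ 0 ≤ k := by linarith [hk.1]
    have hk1 : |-f k + c / k ^ 2 * f k| ≤ Q := by
      have h1 := (hD k hkΛ).1
      calc |-f k + c / k ^ 2 * f k| ≤ |f k| + |c| / k ^ 2 * |f k| := by
            refine (abs_add_le _ _).trans ?_
            rw [abs_neg, abs_mul, abs_div, abs_of_nonneg (sq_nonneg k)]
        _ ≤ D + |c| / Λ 0 ^ 2 * D := by gcongr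
        _ = Q := by rw [hQ]; ring
    have hmn : 0 < m - Λ n := by linarith [hm.1]
    simp only [hm0] at hk0
    rw [hk0, abs_div, zero_sub, abs_neg, abs_of_pos hmn, div_le_iff₀ hmn] at hk1
    rw [div_le_iff₀ hQ0]
    have := hge n
    nlinarith [hm.2]
  refine ⟨min (Λ 0) (e / Q), lt_min hp (by positivity), fun n => ?_⟩
  induction n with
  | zero => simp
  | succ n ih =>
    have := hgap n
    have h2 := min_le_right (Λ 0) (e / Q)
    push_cast
    linarith

lemma exists_zero_sub_bounds (hf : SolvesBesselODE c f f') (hΛ : EnumeratesPositiveZeros f Λ) :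
    ∃ A : ℝ, ∃ N : ℕ, ∀ n, N ≤ n → |Λ (n + 1) - Λ n - π| ≤ A * (1 / Λ n - 1 / Λ (n + 1)) := by
  obtain ⟨e, he, hge⟩ := hf.exists_abs_deriv_zero_ge hΛ
  obtain ⟨A, hA, hamp⟩ := hf.exists_norm_amplitude_sub_le (hΛ.pos 0)
  obtain ⟨s, hs, hsΛ⟩ := hf.exists_mul_le_zero hΛ
  obtain ⟨N, hN⟩ := exists_nat_gt ((1 + 2 * A / e) / s)
  refine ⟨π / 2 * (A / e), N, fun n hn => ?_⟩
  have hpi := Real.pi_pos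
  have hK : 1 + 2 * A / e < Λ n := by
    rw [div_lt_iff₀ hs] at hN
    have h1 : (N : ℝ) ≤ n := by exact_mod_cast hn
    nlinarith [hsΛ n]
  have hAe : 0 < A / e := by positivity
  rw [mul_div_assoc] at hK
  have hn0 := hΛ.pos n
  have hlt : Λ n < Λ (n + 1) := hΛ.strictMono (Nat.lt_succ_self n)
  have hΛ0 : Λ 0 ≤ Λ n := hΛ.strictMono.monotone (Nat.zero_le n)
  have hclose (z : ℝ) (hz : Λ n ≤ z) :
      |f z - Real.sin (z - Λ n) * f' (Λ n)| ≤ A * (1 / Λ n - 1 / z) :=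
    (abs_sub_sin_mul_le (hΛ.eq_zero n) z).trans (hamp _ _ hΛ0 hz)
  set g : ℝ := Λ (n + 1) - Λ n with hg
  have hsin : |Real.sin g| ≤ A / e * (1 / Λ n - 1 / Λ (n + 1)) := by
    have h1 := hclose (Λ (n + 1)) hlt.le
    rw [hΛ.eq_zero (n + 1), zero_sub, abs_neg, abs_mul] at h1
    have h2 : |Real.sin g| * e ≤ A * (1 / Λ n - 1 / Λ (n + 1)) :=
      (mul_le_mul_of_nonneg_left (hge n) (abs_nonneg _)).trans h1
    rw [div_mul_eq_mul_div, le_div_iff₀ he]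
    exact h2
  have hlower : π / 2 ≤ g := by
    by_contra! hcon
    have hg0 : 0 < g := by linarith
    have h1 : 2 / π * g ≤ Real.sin g := Real.mul_le_sin hg0.le hcon.le
    have h2 : 1 / 2 * g ≤ A / e * (1 / Λ n - 1 / Λ (n + 1)) := by
      have h3 : (1 : ℝ) / 2 ≤ 2 / π := by
        rw [div_le_div_iff₀ two_pos hpi]
        linarith [Real.pi_lt_four]
      calc 1 / 2 * g ≤ 2 / π * g := by gcongr
        _ ≤ _ := (h1.trans (le_abs_self _)).trans hsin
    have h4 : 1 / Λ n - 1 / Λ (n + 1) = g / (Λ n * Λ (n + 1)) := by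
      rw [hg]
      have := hΛ.pos (n + 1)
      field_simp
    have h5 : 0 < Λ n * Λ (n + 1) := mul_pos hn0 (hΛ.pos _)
    rw [h4, ← mul_div_assoc, le_div_iff₀ h5] at h2
    have h6 : 2 * (A / e) < Λ n * Λ (n + 1) := by nlinarith
    nlinarith
  have hupper : g ≤ 3 * π / 2 := by
    have hsmall (z : ℝ) (hz : Λ n ≤ z) : |f z - Real.sin (z - Λ n) * f' (Λ n)| < |f' (Λ n)| := by
      have hz0 : 0 < 1 / z := one_div_pos.2 (by linarith)
      have h1 : A * (1 / Λ n - 1 / z) < e := by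
        have h2 : A < e * Λ n := by
          have : A / e < Λ n := by linarith
          rw [div_lt_iff₀ he] at this
          linarith
        have h3 : A * (1 / Λ n) < e := by
          rw [mul_one_div, div_lt_iff₀ hn0]
          exact h2
        nlinarith
      exact ((hclose z hz).trans_lt h1).trans_le (hge n)
    have ha := hsmall (Λ n + π / 2) (by linarith)
    have hb := hsmall (Λ n + 3 * π / 2) (by linarith)
    rw [show Λ n + π / 2 - Λ n = π / 2 by ring, Real.sin_pi_div_two, one_mul] at ha
    rw [show Λ n + 3 * π / 2 - Λ n = π / 2 + π by ring, Real.sin_add_pi,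
      Real.sin_pi_div_two, neg_one_mul] at hb
    have hcont : ContinuousOn f (uIcc (Λ n + π / 2) (Λ n + 3 * π / 2)) := by
      rw [uIcc_of_le (by linarith)]
      exact fun z hz => (hf.deriv_fst z (by linarith [hz.1])).continuousAt.continuousWithinAt
    have hmem : (0 : ℝ) ∈ uIcc (f (Λ n + π / 2)) (f (Λ n + 3 * π / 2)) := by
      rw [mem_uIcc]
      rw [abs_lt] at ha hb
      rcases le_total 0 (f' (Λ n)) with hsgn | hsgn
      · rw [abs_of_nonneg hsgn] at ha hb
        exact Or.inr ⟨by linarith, by linarith⟩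
      · rw [abs_of_nonpos hsgn] at ha hb
        exact Or.inl ⟨by linarith, by linarith⟩
    obtain ⟨z, hz, hz0⟩ := intermediate_value_uIcc hcont hmem
    rw [uIcc_of_le (by linarith)] at hz
    obtain ⟨m, hm⟩ := hΛ.exists_eq z (by linarith [hz.1]) hz0
    have hnm : n < m := by
      rw [← hΛ.strictMono.lt_iff_lt, hm]
      linarith [hz.1]
    have := hΛ.strictMono.monotone (Nat.succ_le_of_lt hnm)
    rw [hm] at this
    simp only [Nat.succ_eq_add_one] at this
    linarith [hz.2]
  have hsin2 : 2 / π * |g - π| ≤ |Real.sin (g - π)| :=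
    Real.mul_abs_le_abs_sin (abs_le.2 ⟨by linarith, by linarith⟩)
  rw [Real.sin_sub_pi, abs_neg] at hsin2
  calc |g - π| = π / 2 * (2 / π * |g - π|) := by field_simp
    _ ≤ π / 2 * (A / e * (1 / Λ n - 1 / Λ (n + 1))) :=
      mul_le_mul_of_nonneg_left (hsin2.trans hsin) (by positivity)
    _ = _ := by ring

lemma sum_one_div_sub_le (hΛ : EnumeratesPositiveZeros f Λ) (m N : ℕ) :
    ∑ k ∈ Finset.range N, (1 / Λ (k + m) - 1 / Λ (k + m + 1)) ≤ 1 / Λ 0 := by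
  have h := Finset.sum_range_sub' (fun k => 1 / Λ (k + m)) N
  have h2 : ∑ k ∈ Finset.range N, (1 / Λ (k + m) - 1 / Λ (k + m + 1))
      = 1 / Λ (0 + m) - 1 / Λ (N + m) := by
    rw [← h]
    refine Finset.sum_congr rfl fun k _ => ?_
    rw [show k + m + 1 = k + 1 + m by ring]
  rw [h2]
  have h3 : 0 < 1 / Λ (N + m) := one_div_pos.2 (hΛ.pos _)
  have h4 : 1 / Λ (0 + m) ≤ 1 / Λ 0 :=
    one_div_le_one_div_of_le (hΛ.pos 0) (hΛ.strictMono.monotone (Nat.zero_le _))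
  linarith

lemma exists_sum_abs_zero_sub_le (hf : SolvesBesselODE c f f')
    (hΛ : EnumeratesPositiveZeros f Λ) :
    ∃ H : ℝ, 0 ≤ H ∧ ∀ N, ∑ k ∈ Finset.range N, |Λ (k + 1) - Λ k - π| ≤ H := by
  obtain ⟨A, N, h⟩ := hf.exists_zero_sub_bounds hΛ
  have hs : Summable fun k => |Λ (k + 1) - Λ k - π| := by
    rw [← summable_nat_add_iff N]
    have hnn (k : ℕ) : 0 ≤ 1 / Λ (k + N) - 1 / Λ (k + N + 1) :=
      sub_nonneg.2 (one_div_le_one_div_of_le (hΛ.pos _)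
        (hΛ.strictMono (Nat.lt_succ_self _)).le)
    refine Summable.of_nonneg_of_le (fun _ => abs_nonneg _) (fun k => h (k + N) (by omega)) ?_
    exact (summable_of_sum_range_le hnn fun M => sum_one_div_sub_le hΛ N M).mul_left A
  exact ⟨_, tsum_nonneg fun _ => abs_nonneg _,
    fun M => hs.sum_le_tsum _ fun _ _ => abs_nonneg _⟩

lemma exists_abs_inv_deriv_zero_sub_le (hf : SolvesBesselODE c f f')
    (hΛ : EnumeratesPositiveZeros f Λ) :
    ∃ H : ℝ, 0 ≤ H ∧ (∀ n, |f' (Λ n)|⁻¹ ≤ H) ∧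
      ∀ N, ∑ k ∈ Finset.range N, |(|f' (Λ (k + 1))|⁻¹ - |f' (Λ k)|⁻¹)| ≤ H := by
  obtain ⟨e, he, hge⟩ := hf.exists_abs_deriv_zero_ge hΛ
  obtain ⟨A, hA, hamp⟩ := hf.exists_norm_amplitude_sub_le (hΛ.pos 0)
  have hn (n : ℕ) : ‖amplitude f f' (Λ n)‖ = |f' (Λ n)| := by
    rw [← abs_norm, ← sq_eq_sq_iff_abs_eq_abs, norm_amplitude, hΛ.eq_zero n]
    ring
  have hstep (k : ℕ) : |(|f' (Λ (k + 1))|⁻¹ - |f' (Λ k)|⁻¹)|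
      ≤ A / e ^ 2 * (1 / Λ k - 1 / Λ (k + 1)) := by
    have h1 := (abs_norm_sub_norm_le _ _).trans (hamp (Λ k) (Λ (k + 1))
      (hΛ.strictMono.monotone (Nat.zero_le k)) (hΛ.strictMono (Nat.lt_succ_self k)).le)
    rw [hn, hn] at h1
    have ha : 0 < |f' (Λ (k + 1))| := he.trans_le (hge _)
    have hb : 0 < |f' (Λ k)| := he.trans_le (hge _)
    rw [inv_sub_inv ha.ne' hb.ne', abs_div, abs_mul, abs_abs, abs_abs, abs_sub_comm]
    calc _ ≤ A * (1 / Λ k - 1 / Λ (k + 1)) / (e * e) := by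
          gcongr
          · exact (abs_nonneg _).trans h1
          · exact hge _
          · exact hge _
      _ = _ := by ring
  refine ⟨e⁻¹ + A / e ^ 2 * (1 / Λ 0), ?_, fun n => ?_, fun N => ?_⟩
  · have := hΛ.pos 0
    positivity
  · have h1 : |f' (Λ n)|⁻¹ ≤ e⁻¹ := inv_anti₀ he (hge n)
    have h2 : 0 ≤ A / e ^ 2 * (1 / Λ 0) := by
      have := hΛ.pos 0
      positivity
    linarith
  · refine (Finset.sum_le_sum fun k _ => hstep k).trans ?_
    rw [← Finset.mul_sum]
    have h1 := sum_one_div_sub_le hΛ 0 N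
    simp only [add_zero] at h1
    have h2 : 0 < e⁻¹ := inv_pos.2 he
    have h3 : A / e ^ 2 * ∑ k ∈ Finset.range N, (1 / Λ k - 1 / Λ (k + 1))
        ≤ A / e ^ 2 * (1 / Λ 0) := by gcongr
    linarith

end SolvesBesselODE

/-- A sequence bounded by `M` and of total variation at most `M`. -/
def BVSeq (M : ℝ) (a : ℕ → ℂ) : Prop :=
  (∀ n, ‖a n‖ ≤ M) ∧ ∀ N, ∑ k ∈ Finset.range N, ‖a (k + 1) - a k‖ ≤ M

namespace BVSeq

lemma nonneg {M : ℝ} {a : ℕ → ℂ} (h : BVSeq M a) : 0 ≤ M := (norm_nonneg _).trans (h.1 0)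

lemma mul {M L : ℝ} {a b : ℕ → ℂ} (ha : BVSeq M a) (hb : BVSeq L b) :
    BVSeq (2 * M * L) fun n => a n * b n := by
  have hM := ha.nonneg
  have hL := hb.nonneg
  constructor
  · intro n
    rw [norm_mul]
    calc ‖a n‖ * ‖b n‖ ≤ M * L := by
          gcongr
          exacts [ha.1 n, hb.1 n]
      _ ≤ 2 * M * L := by nlinarith [mul_nonneg hM hL]
  · intro N
    have hstep (k : ℕ) : ‖a (k + 1) * b (k + 1) - a k * b k‖
        ≤ M * ‖b (k + 1) - b k‖ + L * ‖a (k + 1) - a k‖ := by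
      rw [show a (k + 1) * b (k + 1) - a k * b k
        = a (k + 1) * (b (k + 1) - b k) + b k * (a (k + 1) - a k) by ring]
      refine (norm_add_le _ _).trans ?_
      rw [norm_mul, norm_mul]
      gcongr
      exacts [ha.1 _, hb.1 _]
    refine (Finset.sum_le_sum fun k _ => hstep k).trans ?_
    rw [Finset.sum_add_distrib, ← Finset.mul_sum, ← Finset.mul_sum]
    nlinarith [mul_le_mul_of_nonneg_left (hb.2 N) hM, mul_le_mul_of_nonneg_left (ha.2 N) hL]

lemma conj {M : ℝ} {a : ℕ → ℂ} (ha : BVSeq M a) :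
    BVSeq M fun n => (starRingEnd ℂ) (a n) := by
  constructor
  · intro n
    rw [RCLike.norm_conj]
    exact ha.1 n
  · intro N
    simp_rw [← map_sub, RCLike.norm_conj]
    exact ha.2 N

lemma of_antitone {a : ℕ → ℝ} (h : Antitone a) (h0 : ∀ n, 0 ≤ a n) :
    BVSeq (a 0) fun n => (a n : ℂ) := by
  constructor
  · intro n
    rw [Complex.norm_real, Real.norm_eq_abs, abs_of_nonneg (h0 n)]
    exact h (Nat.zero_le n)
  · intro N
    have hstep (k : ℕ) : ‖(a (k + 1) : ℂ) - a k‖ = a k - a (k + 1) := by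
      rw [← Complex.ofReal_sub, Complex.norm_real, Real.norm_eq_abs, abs_sub_comm,
        abs_of_nonneg (sub_nonneg.2 (h (Nat.le_succ k)))]
    simp_rw [hstep]
    rw [Finset.sum_range_sub']
    linarith [h0 N]

/-- Dirichlet's test. -/
lemma norm_sum_pow_mul_le {M : ℝ} {b : ℕ → ℂ} (hb : BVSeq M b) {ω : ℂ} (hω : ‖ω‖ = 1) (N : ℕ) :
    ‖ω - 1‖ * ‖∑ k ∈ Finset.range N, ω ^ k * b k‖ ≤ 3 * M := by
  have h : (ω - 1) * ∑ k ∈ Finset.range N, ω ^ k * b k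
      = ω ^ N * b N - b 0 - ∑ k ∈ Finset.range N, ω ^ (k + 1) * (b (k + 1) - b k) := by
    induction N with
    | zero => simp
    | succ n ih =>
      rw [Finset.sum_range_succ, Finset.sum_range_succ, mul_add, ih]
      ring
  rw [← norm_mul, h]
  have h1 : ‖ω ^ N * b N‖ ≤ M := by
    rw [norm_mul, norm_pow, hω, one_pow, one_mul]
    exact hb.1 N
  have h2 : ‖∑ k ∈ Finset.range N, ω ^ (k + 1) * (b (k + 1) - b k)‖ ≤ M := by
    refine (norm_sum_le _ _).trans (le_trans (le_of_eq ?_) (hb.2 N))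
    refine Finset.sum_congr rfl fun k _ => ?_
    rw [norm_mul, norm_pow, hω, one_pow, one_mul]
  linarith [norm_sub_le (ω ^ N * b N - b 0) (∑ k ∈ Finset.range N, ω ^ (k + 1) * (b (k + 1) - b k)),
    norm_sub_le (ω ^ N * b N) (b 0), hb.1 0]

end BVSeq

lemma le_abs_sin_of_le_abs {δ β : ℝ} (hδ : 0 ≤ δ) (h1 : δ ≤ |β|) (h2 : |β| ≤ 2 - δ) :
    δ ≤ |Real.sin (π * β / 2)| := by
  have hpi := Real.pi_pos
  have key (b : ℝ) (hb0 : 0 ≤ b) (hb1 : b ≤ 1) : b ≤ Real.sin (π * b / 2) := by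
    have h := Real.mul_le_sin (x := π * b / 2) (by positivity) (by nlinarith)
    calc b = 2 / π * (π * b / 2) := by field_simp
      _ ≤ _ := h
  have main (b : ℝ) (hb1 : δ ≤ b) (hb2 : b ≤ 2 - δ) : δ ≤ Real.sin (π * b / 2) := by
    rcases le_total b 1 with hb | hb
    · exact hb1.trans (key b (hδ.trans hb1) hb)
    · rw [← Real.sin_pi_sub, show π - π * b / 2 = π * (2 - b) / 2 by ring]
      exact (by linarith : δ ≤ 2 - b).trans (key _ (by linarith) (by linarith))
  rcases abs_choice β with h | h
  · rw [h] at h1 h2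
    exact (main β h1 h2).trans (le_abs_self _)
  · rw [h] at h1 h2
    have := main (-β) h1 h2
    rw [show π * -β / 2 = -(π * β / 2) by ring, Real.sin_neg] at this
    exact this.trans (neg_le_abs _)

/-- Oscillatory sums with frequencies `Λ n = π n + η n`, `η` of bounded variation. -/
lemma norm_sum_exp_mul_le {Λ : ℕ → ℝ} {H : ℝ}
    (hΛ : ∀ N, ∑ k ∈ Finset.range N, |Λ (k + 1) - Λ k - π| ≤ H) {M : ℝ} {b : ℕ → ℂ}
    (hb : BVSeq M b) {δ β : ℝ} (hδ : 0 < δ) (h1 : δ ≤ |β|) (h2 : |β| ≤ 2 - δ) (N : ℕ) :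
    ‖∑ k ∈ Finset.range N, Complex.exp (((Λ k * β : ℝ) : ℂ) * Complex.I) * b k‖
      ≤ 3 * (1 + 2 * H) * M / δ := by
  have hH : 0 ≤ H := by simpa using hΛ 0
  have hM := hb.nonneg
  set ω : ℂ := Complex.exp (Complex.I * ((π * β : ℝ) : ℂ)) with hω
  have hω1 : ‖ω‖ = 1 := Complex.norm_exp_I_mul_ofReal _
  have hω2 : 2 * δ ≤ ‖ω - 1‖ := by
    rw [hω, Complex.norm_exp_I_mul_ofReal_sub_one, norm_mul, Real.norm_eq_abs, Real.norm_eq_abs,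
      abs_two]
    linarith [le_abs_sin_of_le_abs hδ.le h1 h2]
  set p : ℕ → ℂ := fun k => Complex.exp (Complex.I * (((Λ k - π * k) * β : ℝ) : ℂ)) with hp
  have hpBV : BVSeq (1 + 2 * H) p := by
    constructor
    · intro n
      rw [hp]
      simp only
      rw [Complex.norm_exp_I_mul_ofReal]
      linarith
    · intro n
      have hstep (k : ℕ) : ‖p (k + 1) - p k‖ ≤ 2 * |Λ (k + 1) - Λ k - π| := by
        have e : p (k + 1) - p k = p k *
            (Complex.exp (Complex.I * (((Λ (k + 1) - Λ k - π) * β : ℝ) : ℂ)) - 1) := by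
          simp only [hp]
          rw [mul_sub, ← Complex.exp_add, mul_one]
          congr 2
          push_cast
          ring
        rw [e, norm_mul, hp, Complex.norm_exp_I_mul_ofReal, one_mul]
        refine (Real.norm_exp_I_mul_ofReal_sub_one_le).trans ?_
        rw [Real.norm_eq_abs, abs_mul, mul_comm]
        gcongr
        linarith
      refine (Finset.sum_le_sum fun k _ => hstep k).trans ?_
      rw [← Finset.mul_sum]
      linarith [hΛ n]
  have h := (hpBV.mul hb).norm_sum_pow_mul_le hω1 N
  have e : ∑ k ∈ Finset.range N, Complex.exp (((Λ k * β : ℝ) : ℂ) * Complex.I) * b k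
      = ∑ k ∈ Finset.range N, ω ^ k * (p k * b k) := by
    refine Finset.sum_congr rfl fun k _ => ?_
    rw [hω, hp, ← mul_assoc, ← Complex.exp_nat_mul, ← Complex.exp_add]
    congr 2
    push_cast
    ring
  rw [e, le_div_iff₀ hδ]
  nlinarith [norm_nonneg (∑ k ∈ Finset.range N, ω ^ k * (p k * b k))]

lemma HasBVAmplitude.mono {M L : ℝ} {f : ℝ → ℝ} (hf : HasBVAmplitude M f) (hML : M ≤ L) :
    HasBVAmplitude L f := by
  obtain ⟨W, V, h, hW, hV, hWV⟩ := hf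
  exact ⟨W, V, h, fun z hz => (hW z hz).trans hML, fun z hz => (hV z hz).trans hML, hWV⟩

lemma HasBVAmplitude.abs_le {M : ℝ} {f : ℝ → ℝ} (hf : HasBVAmplitude M f) {z : ℝ} (hz : 0 < z) :
    |f z| ≤ M := by
  obtain ⟨W, V, h, hW, -, -⟩ := hf
  rw [h z hz]
  refine (Complex.abs_re_le_norm _).trans ?_
  rw [norm_mul, Complex.norm_exp_ofReal_mul_I, one_mul]
  exact hW z hz

lemma bvSeq_comp {M : ℝ} {W : ℝ → ℂ} {V : ℝ → ℝ} (hW : ∀ z, 0 < z → ‖W z‖ ≤ M)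
    (hV : ∀ z, 0 < z → |V z| ≤ M) (hWV : ∀ a b, 0 < a → a ≤ b → ‖W b - W a‖ ≤ V b - V a)
    {u : ℕ → ℝ} (hu : Monotone u) (hu0 : ∀ n, 0 < u n) : BVSeq (2 * M) fun n => W (u n) := by
  have hM : 0 ≤ M := (norm_nonneg _).trans (hW _ (hu0 0))
  refine ⟨fun n => (hW _ (hu0 n)).trans (by linarith), fun N => ?_⟩
  refine (Finset.sum_le_sum fun k _ => hWV _ _ (hu0 k) (hu (Nat.le_succ k))).trans ?_
  rw [Finset.sum_range_sub (fun k => V (u k))]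
  linarith [(abs_le.1 (hV _ (hu0 N))).2, (abs_le.1 (hV _ (hu0 0))).1]

lemma abs_sum_mul_amplitudes_le {Λ : ℕ → ℝ} (hmono : Monotone Λ) (hpos : ∀ n, 0 < Λ n) {H : ℝ}
    (hΛ : ∀ N, ∑ k ∈ Finset.range N, |Λ (k + 1) - Λ k - π| ≤ H) {L M : ℝ} {q : ℕ → ℝ}
    (hq : BVSeq L fun n => (q n : ℂ)) {f g : ℝ → ℝ} (hf : HasBVAmplitude M f)
    (hg : HasBVAmplitude M g) {x y : ℝ} (hx : x ∈ Ioo (0 : ℝ) 1) (hy : y ∈ Ioo (0 : ℝ) 1)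
    (hxy : x ≠ y) (N : ℕ) :
    |∑ k ∈ Finset.range N, q k * f (Λ k * x) * g (Λ k * y)|
      ≤ 48 * (1 + 2 * H) * L * M ^ 2 / |x - y| := by
  obtain ⟨W, V, hfW, hW, hV, hWV⟩ := hf
  obtain ⟨W₁, V₁, hgW, hW₁, hV₁, hWV₁⟩ := hg
  have hWx := bvSeq_comp hW hV hWV (hmono.mul_const hx.1.le) fun n => mul_pos (hpos n) hx.1
  have hWy := bvSeq_comp hW₁ hV₁ hWV₁ (hmono.mul_const hy.1.le) fun n => mul_pos (hpos n) hy.1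
  have hδ : 0 < |x - y| := abs_pos.2 (sub_ne_zero.2 hxy)
  obtain ⟨hx0, hx1⟩ := hx
  obtain ⟨hy0, hy1⟩ := hy
  have hsum := norm_sum_exp_mul_le hΛ (hq.mul (hWx.mul hWy)) (β := x + y) hδ
    (by rw [abs_of_pos (add_pos hx0 hy0), abs_le]; constructor <;> linarith)
    (by rw [abs_of_pos (add_pos hx0 hy0)]
        have : |x - y| ≤ 2 - (x + y) := abs_le.2 ⟨by linarith, by linarith⟩
        linarith) N
  have hdiff := norm_sum_exp_mul_le hΛ (hq.mul (hWx.mul hWy.conj)) (β := x - y) hδ le_rfl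
    (by have : |x - y| ≤ 1 := abs_le.2 ⟨by linarith, by linarith⟩
        linarith) N
  set S₁ := ∑ k ∈ Finset.range N, Complex.exp (((Λ k * (x + y) : ℝ) : ℂ) * Complex.I) *
    (q k * (W (Λ k * x) * W₁ (Λ k * y))) with hS₁
  set S₂ := ∑ k ∈ Finset.range N, Complex.exp (((Λ k * (x - y) : ℝ) : ℂ) * Complex.I) *
    (q k * (W (Λ k * x) * (starRingEnd ℂ) (W₁ (Λ k * y)))) with hS₂
  have e : ∑ k ∈ Finset.range N, q k * f (Λ k * x) * g (Λ k * y) = (S₁ + S₂).re / 2 := by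
    rw [hS₁, hS₂, ← Finset.sum_add_distrib, Complex.re_sum, Finset.sum_div]
    refine Finset.sum_congr rfl fun k _ => ?_
    rw [hfW _ (mul_pos (hpos k) hx0), hgW _ (mul_pos (hpos k) hy0)]
    have e1 : Complex.exp (((Λ k * (x + y) : ℝ) : ℂ) * Complex.I)
        = Complex.exp (((Λ k * x : ℝ) : ℂ) * Complex.I) *
          Complex.exp (((Λ k * y : ℝ) : ℂ) * Complex.I) := by
      rw [← Complex.exp_add]
      congr 1
      push_cast
      ring
    have e2 : Complex.exp (((Λ k * (x - y) : ℝ) : ℂ) * Complex.I)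
        = Complex.exp (((Λ k * x : ℝ) : ℂ) * Complex.I) *
          (starRingEnd ℂ) (Complex.exp (((Λ k * y : ℝ) : ℂ) * Complex.I)) := by
      rw [← Complex.exp_conj, ← Complex.exp_add, map_mul, Complex.conj_I, Complex.conj_ofReal]
      congr 1
      push_cast
      ring
    rw [e1, e2]
    generalize Complex.exp (((Λ k * x : ℝ) : ℂ) * Complex.I) = A
    generalize Complex.exp (((Λ k * y : ℝ) : ℂ) * Complex.I) = B
    simp only [Complex.add_re, Complex.mul_re, Complex.mul_im, Complex.conj_re, Complex.conj_im,
      Complex.ofReal_re, Complex.ofReal_im]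
    ring
  rw [e, abs_div, abs_two]
  have h3 : |(S₁ + S₂).re| ≤ ‖S₁‖ + ‖S₂‖ := (Complex.abs_re_le_norm _).trans (norm_add_le _ _)
  calc |(S₁ + S₂).re| / 2 ≤ (3 * (1 + 2 * H) * (2 * L * (2 * (2 * M) * (2 * M))) / |x - y|
        + 3 * (1 + 2 * H) * (2 * L * (2 * (2 * M) * (2 * M))) / |x - y|) / 2 := by linarith
    _ = _ := by ring

lemma exists_tsum_exp_le {Λ : ℕ → ℝ} {s : ℝ} (hs : 0 < s) (hΛ : ∀ n : ℕ, s * (n + 1) ≤ Λ n) :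
    ∃ K : ℝ, 0 < K ∧ ∀ t, 0 < t → (Summable fun n => Real.exp (-t * Λ n)) ∧
      ∑' n, Real.exp (-t * Λ n) ≤ K / t ^ 2 := by
  have hsum : Summable fun n : ℕ => 1 / ((n : ℝ) + 1) ^ 2 := by
    have h := (summable_nat_add_iff 1).2 (Real.summable_one_div_nat_pow.2 one_lt_two)
    simpa using h
  have hnn : 0 ≤ ∑' n : ℕ, 1 / ((n : ℝ) + 1) ^ 2 := tsum_nonneg fun _ => by positivity
  refine ⟨2 / s ^ 2 * (∑' n : ℕ, 1 / ((n : ℝ) + 1) ^ 2 + 1), by positivity, fun t ht => ?_⟩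
  have hle (n : ℕ) : Real.exp (-t * Λ n) ≤ 2 / (s ^ 2 * t ^ 2) * (1 / ((n : ℝ) + 1) ^ 2) := by
    have hx : 0 < t * (s * (n + 1)) := by positivity
    have h1 : (t * (s * (n + 1))) ^ 2 / 2 ≤ Real.exp (t * Λ n) := by
      have h2 := Real.quadratic_le_exp_of_nonneg hx.le
      have h3 : Real.exp (t * (s * (n + 1))) ≤ Real.exp (t * Λ n) := by
        gcongr
        exact hΛ n
      linarith
    rw [neg_mul, Real.exp_neg]
    calc (Real.exp (t * Λ n))⁻¹ ≤ ((t * (s * (n + 1))) ^ 2 / 2)⁻¹ := by gcongr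
      _ = _ := by field_simp
  have hS := hsum.mul_left (2 / (s ^ 2 * t ^ 2))
  have hE : Summable fun n => Real.exp (-t * Λ n) :=
    Summable.of_nonneg_of_le (fun _ => (Real.exp_pos _).le) hle hS
  refine ⟨hE, (hE.tsum_le_tsum hle hS).trans ?_⟩
  rw [tsum_mul_left]
  calc 2 / (s ^ 2 * t ^ 2) * ∑' n : ℕ, 1 / ((n : ℝ) + 1) ^ 2
      = 2 / s ^ 2 * (∑' n : ℕ, 1 / ((n : ℝ) + 1) ^ 2) / t ^ 2 := by field_simp
    _ ≤ _ := by
      gcongr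
      linarith

lemma solvesBesselODE_sqrtMulBesselJ {ν : ℝ} (hν : -(1/2 : ℝ) < ν) :
    SolvesBesselODE ((ν + 1/2) ^ 2 - (ν + 1/2)) (sqrtMulBesselJ ν)
      (fun z => (ν + 1/2) / z * sqrtMulBesselJ ν z - sqrtMulBesselJ (ν + 1) z) := by
  refine ⟨fun z hz => hasDerivAt_sqrtMulBesselJ hν hz, fun z hz => ?_⟩
  have h1 : HasDerivAt (fun z : ℝ => (ν + 1/2) / z) (-(ν + 1/2) / z ^ 2) z := by
    refine ((hasDerivAt_inv hz.ne').const_mul (ν + 1/2)).congr_deriv ?_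
    ring
  refine ((h1.mul (hasDerivAt_sqrtMulBesselJ hν hz)).sub
    (hasDerivAt_sqrtMulBesselJ_succ hν hz)).congr_deriv ?_
  field_simp
  ring

lemma solvesBesselODE_sqrtMulBesselJ_succ {ν : ℝ} (hν : -(1/2 : ℝ) < ν) :
    SolvesBesselODE ((ν + 1/2) ^ 2 + (ν + 1/2)) (sqrtMulBesselJ (ν + 1))
      (fun z => sqrtMulBesselJ ν z - (ν + 1/2) / z * sqrtMulBesselJ (ν + 1) z) := by
  refine ⟨fun z hz => hasDerivAt_sqrtMulBesselJ_succ hν hz, fun z hz => ?_⟩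
  have h1 : HasDerivAt (fun z : ℝ => (ν + 1/2) / z) (-(ν + 1/2) / z ^ 2) z := by
    refine ((hasDerivAt_inv hz.ne').const_mul (ν + 1/2)).congr_deriv ?_
    ring
  refine ((hasDerivAt_sqrtMulBesselJ hν hz).sub (h1.mul
    (hasDerivAt_sqrtMulBesselJ_succ hν hz))).congr_deriv ?_
  field_simp
  ring

lemma exists_hasBVAmplitude_sqrtMulBesselJ {ν : ℝ} (hν : -(1/2 : ℝ) < ν) :
    ∃ M : ℝ, HasBVAmplitude M (sqrtMulBesselJ ν) ∧ HasBVAmplitude M (sqrtMulBesselJ (ν + 1)) := by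
  have hκ : 0 < ν + 1/2 := by linarith
  obtain ⟨C, hC⟩ := exists_abs_sqrtMulBesselJ_le hν
  obtain ⟨C₁, hC₁⟩ := exists_abs_sqrtMulBesselJ_le (ν := ν + 1) (by linarith)
  have hC0 : 0 ≤ C := by simpa using (abs_nonneg _).trans (hC 1 one_pos le_rfl)
  have hC10 : 0 ≤ C₁ := by simpa using (abs_nonneg _).trans (hC₁ 1 one_pos le_rfl)
  set κ := ν + 1/2 with hκdef
  set B := (κ + 1) * (C + C₁) with hB
  have hCB : C + C₁ ≤ B := by nlinarith
  have hκC : κ * (C + C₁) ≤ B := by nlinarith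
  have hu (z : ℝ) (hz : 0 < z) (hz1 : z ≤ 1) : |sqrtMulBesselJ ν z| ≤ (C + C₁) * z ^ κ := by
    refine (hC z hz hz1).trans ?_
    gcongr
    linarith
  have hu₁ (z : ℝ) (hz : 0 < z) (hz1 : z ≤ 1) : |sqrtMulBesselJ (ν + 1) z| ≤ (C + C₁) * z ^ κ := by
    refine (hC₁ z hz hz1).trans ?_
    have : z ^ (ν + 1 + 1/2) ≤ z ^ κ :=
      Real.rpow_le_rpow_of_exponent_ge hz hz1 (by rw [hκdef]; linarith)
    gcongr
    linarith
  have hbound (f : ℝ → ℝ)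
      (hf : ∀ z, 0 < z → z ≤ 1 → |f z| ≤ (C + C₁) * z ^ κ) (z : ℝ) (hz : 0 < z) (hz1 : z ≤ 1) :
      |f z| ≤ B ∧ |κ / z * f z| ≤ B * z ^ (κ - 1) := by
    have hk0 : 0 < z ^ κ := by positivity
    have hk1 : z ^ κ ≤ 1 := Real.rpow_le_one hz.le hz1 hκ.le
    have h1 := hf z hz hz1
    constructor
    · nlinarith
    · rw [abs_mul, abs_of_pos (by positivity : 0 < κ / z), Real.rpow_sub_one hz.ne']
      calc κ / z * |f z| ≤ κ / z * ((C + C₁) * z ^ κ) := by gcongr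
        _ = κ * (C + C₁) * (z ^ κ / z) := by ring
        _ ≤ _ := by gcongr
  obtain ⟨M, hM⟩ := (solvesBesselODE_sqrtMulBesselJ hν).exists_hasBVAmplitude (C := B) hκ
    (fun z hz hz1 => (hbound _ hu z hz hz1).1) fun z hz hz1 => by
      refine (abs_sub _ _).trans ?_
      linarith [(hbound _ hu z hz hz1).2, (hbound _ hu₁ z hz hz1).1]
  obtain ⟨M₁, hM₁⟩ := (solvesBesselODE_sqrtMulBesselJ_succ hν).exists_hasBVAmplitude (C := B) hκ
    (fun z hz hz1 => (hbound _ hu₁ z hz hz1).1) fun z hz hz1 => by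
      refine (abs_sub _ _).trans ?_
      linarith [(hbound _ hu₁ z hz hz1).2, (hbound _ hu z hz hz1).1]
  exact ⟨max M M₁, hM.mono (le_max_left _ _), hM₁.mono (le_max_right _ _)⟩

lemma enumeratesPositiveZeros_sqrtMulBesselJ {ν : ℝ} {Λ : ℕ → ℝ}
    (hΛ : IsPositiveZerosOfBesselJ ν Λ) : EnumeratesPositiveZeros (sqrtMulBesselJ ν) Λ := by
  obtain ⟨h1, h2, h3, h4⟩ := hΛ
  refine ⟨h1, h2, fun n => by rw [sqrtMulBesselJ, h3, mul_zero], fun z hz h => h4 z hz ?_⟩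
  rw [sqrtMulBesselJ] at h
  exact (mul_eq_zero.1 h).resolve_left (ne_of_gt (Real.sqrt_pos.2 hz))

/-- The weight `2 / (λ J_{ν+1}(λ)²)` at a zero `λ = Λ n`. -/
noncomputable def zeroWeight (ν : ℝ) (Λ : ℕ → ℝ) (n : ℕ) : ℝ :=
  2 * (|sqrtMulBesselJ (ν + 1) (Λ n)|⁻¹ * |sqrtMulBesselJ (ν + 1) (Λ n)|⁻¹)

lemma sq_normalization_mul_sq {ν : ℝ} {Λ : ℕ → ℝ} (n : ℕ) (hn : 0 < Λ n) :
    (√2 / |Λ n * besselJ (ν + 1) (Λ n)|) ^ 2 * Λ n = zeroWeight ν Λ n := by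
  have hs : √(Λ n) * √(Λ n) = Λ n := Real.mul_self_sqrt hn.le
  have h2 : √2 ^ 2 = 2 := Real.sq_sqrt zero_le_two
  rw [zeroWeight, sqrtMulBesselJ, div_pow, sq_abs, h2, ← mul_inv, abs_mul_abs_self]
  rw [show √(Λ n) * besselJ (ν + 1) (Λ n) * (√(Λ n) * besselJ (ν + 1) (Λ n))
    = Λ n * besselJ (ν + 1) (Λ n) ^ 2 by
    linear_combination besselJ (ν + 1) (Λ n) ^ 2 * hs]
  field_simp

lemma sqrtMulBesselJ_mul_sqrtMulBesselJ (μ ν : ℝ) {l x y : ℝ} (hl : 0 < l) (hx : 0 < x) :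
    sqrtMulBesselJ μ (l * x) * sqrtMulBesselJ ν (l * y)
      = l * √(x * y) * besselJ μ (l * x) * besselJ ν (l * y) := by
  have hs : √l * √l = l := Real.mul_self_sqrt hl.le
  rw [sqrtMulBesselJ, sqrtMulBesselJ, Real.sqrt_mul hl.le, Real.sqrt_mul hl.le,
    Real.sqrt_mul hx.le]
  linear_combination √x * √y * besselJ μ (l * x) * besselJ ν (l * y) * hs

lemma deltaL_term_eq {ν : ℝ} {Λ : ℕ → ℝ} (t : ℝ) {x y : ℝ} (n : ℕ) (hn : 0 < Λ n)
    (hx : 0 < x) :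
    Real.exp (-t * Λ n) * (√2 / |Λ n * besselJ (ν + 1) (Λ n)|) ^ 2 *
        (Λ n) ^ 2 * √(x * y) * besselJ (ν + 1) (Λ n * x) * besselJ ν (Λ n * y)
      = Real.exp (-t * Λ n) * zeroWeight ν Λ n * sqrtMulBesselJ (ν + 1) (Λ n * x) *
        sqrtMulBesselJ ν (Λ n * y) := by
  rw [← sq_normalization_mul_sq n hn]
  linear_combination -Real.exp (-t * Λ n) * ((√2 / |Λ n * besselJ (ν + 1) (Λ n)|) ^ 2 * Λ n) *
    sqrtMulBesselJ_mul_sqrtMulBesselJ (ν + 1) ν (y := y) hn hx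

lemma pKerL_eq {ν : ℝ} {Λ : ℕ → ℝ} (hΛ : ∀ n, 0 < Λ n) (t : ℝ) {x y : ℝ} (hx : 0 < x)
    (hy : 0 < y) :
    pKerL ν Λ t x y = ∑' n, Real.exp (-t * Λ n) * zeroWeight ν Λ n / Λ n *
      sqrtMulBesselJ ν (Λ n * x) * sqrtMulBesselJ ν (Λ n * y) := by
  rw [pKerL, pKer, ← tsum_mul_left]
  refine tsum_congr fun n => ?_
  have hn := hΛ n
  have hxy : (x * y) ^ (ν + 1/2) * (x ^ (-ν) * y ^ (-ν)) = √(x * y) := by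
    rw [← Real.mul_rpow hx.le hy.le, ← Real.rpow_add (mul_pos hx hy), Real.sqrt_eq_rpow]
    congr 1
    ring
  have hs : √(Λ n) * √(Λ n) = Λ n := Real.mul_self_sqrt hn.le
  have h := sqrtMulBesselJ_mul_sqrtMulBesselJ ν ν (y := y) hn hx
  set D := √2 / |Λ n * besselJ (ν + 1) (Λ n)| with hD
  have hw : zeroWeight ν Λ n / Λ n = D ^ 2 := by
    rw [← sq_normalization_mul_sq n hn, ← hD, mul_div_cancel_right₀ _ hn.ne']
  rw [mul_div_assoc, hw, mul_assoc _ (sqrtMulBesselJ ν (Λ n * x)), h, ← hxy, phiFB, phiFB, ← hD]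
  linear_combination (x * y) ^ (ν + 1/2) * Real.exp (-t * Λ n) * D ^ 2 *
    besselJ ν (Λ n * x) * besselJ ν (Λ n * y) * x ^ (-ν) * y ^ (-ν) * hs

lemma exists_bvSeq_zeroWeight {ν : ℝ} (hν : -(1/2 : ℝ) < ν) {Λ : ℕ → ℝ}
    (hΛ : EnumeratesPositiveZeros (sqrtMulBesselJ ν) Λ) :
    ∃ L : ℝ, BVSeq L fun n => (zeroWeight ν Λ n : ℂ) := by
  obtain ⟨H, hH0, hH1, hH2⟩ :=
    (solvesBesselODE_sqrtMulBesselJ hν).exists_abs_inv_deriv_zero_sub_le hΛ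
  simp only [hΛ.eq_zero, mul_zero, zero_sub, abs_neg] at hH1 hH2
  have hr : BVSeq H fun n => ((|sqrtMulBesselJ (ν + 1) (Λ n)|⁻¹ : ℝ) : ℂ) := by
    constructor
    · intro n
      rw [Complex.norm_real, Real.norm_eq_abs, abs_of_nonneg (by positivity)]
      exact hH1 n
    · intro N
      simp_rw [← Complex.ofReal_sub, Complex.norm_real, Real.norm_eq_abs]
      exact hH2 N
  have h2 : BVSeq 2 fun _ => (2 : ℂ) := by simp [BVSeq]
  have h := h2.mul (hr.mul hr)
  refine ⟨2 * 2 * (2 * H * H), ?_⟩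
  convert h using 2 with n
  rw [zeroWeight]
  push_cast
  ring

lemma hasDerivAt_pKerL {ν : ℝ} (hν : -(1/2 : ℝ) < ν) {Λ : ℕ → ℝ}
    (hΛ : EnumeratesPositiveZeros (sqrtMulBesselJ ν) Λ) {t x y : ℝ} (ht : 0 < t) (hx : 0 < x)
    (hy : 0 < y) :
    ∃ d : ℝ, HasDerivAt (fun x' => pKerL ν Λ t x' y) d x ∧
      -d + ((ν + 1/2) / x) * pKerL ν Λ t x y
        = ∑' n, Real.exp (-t * Λ n) * zeroWeight ν Λ n * sqrtMulBesselJ (ν + 1) (Λ n * x) *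
          sqrtMulBesselJ ν (Λ n * y) := by
  have hode := solvesBesselODE_sqrtMulBesselJ hν
  obtain ⟨M, hM, hM₁⟩ := exists_hasBVAmplitude_sqrtMulBesselJ hν
  obtain ⟨L, hL⟩ := exists_bvSeq_zeroWeight hν hΛ
  obtain ⟨s, hs, hsΛ⟩ := hode.exists_mul_le_zero hΛ
  obtain ⟨K, -, hK⟩ := exists_tsum_exp_le hs hsΛ
  have hpos := hΛ.pos
  have hΛ0 := hpos 0
  obtain ⟨D, hD0, hD⟩ := hode.exists_bound (mul_pos hΛ0 (half_pos hx))
  have hL0 : 0 ≤ L := hL.nonneg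
  have hw (n : ℕ) : |zeroWeight ν Λ n| ≤ L := by
    have := hL.1 n
    rwa [Complex.norm_real] at this
  set df : ℝ → ℝ := fun z => (ν + 1/2) / z * sqrtMulBesselJ ν z - sqrtMulBesselJ (ν + 1) z with hdf
  set g : ℕ → ℝ → ℝ := fun n r => Real.exp (-t * Λ n) * zeroWeight ν Λ n / Λ n *
      sqrtMulBesselJ ν (Λ n * r) * sqrtMulBesselJ ν (Λ n * y) with hg
  set g' : ℕ → ℝ → ℝ := fun n r => Real.exp (-t * Λ n) * zeroWeight ν Λ n *
      df (Λ n * r) * sqrtMulBesselJ ν (Λ n * y) with hg'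
  have hM0 : 0 ≤ M := (abs_nonneg _).trans (hM.abs_le one_pos)
  have hub : Summable fun n => L * D * M * Real.exp (-t * Λ n) := (hK t ht).1.mul_left _
  have hderiv (n : ℕ) (r : ℝ) (hr : r ∈ Ioi (x / 2)) : HasDerivAt (g n) (g' n r) r := by
    have hr0 : 0 < r := (half_pos hx).trans hr
    have hn := hpos n
    have h1 : HasDerivAt (fun r => Λ n * r) (Λ n) r := by
      simpa using (hasDerivAt_id r).const_mul (Λ n)
    have h2 := ((((hode.deriv_fst _ (mul_pos hn hr0)).comp r h1).const_mul
      (Real.exp (-t * Λ n) * zeroWeight ν Λ n / Λ n)).mul_const (sqrtMulBesselJ ν (Λ n * y)))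
    refine h2.congr_deriv ?_
    rw [hg']
    field_simp
  have hbound (n : ℕ) (r : ℝ) (hr : r ∈ Ioi (x / 2)) :
      ‖g' n r‖ ≤ L * D * M * Real.exp (-t * Λ n) := by
    have hn := hpos n
    have hle : Λ 0 * (x / 2) ≤ Λ n * r := by
      have := hΛ.strictMono.monotone (Nat.zero_le n)
      have hr' : x / 2 ≤ r := le_of_lt hr
      gcongr
    have h1 := (hD _ hle).2
    have h2 := hM.abs_le (mul_pos hn hy)
    have h3 := hw n
    rw [hg', Real.norm_eq_abs, abs_mul, abs_mul, abs_mul, abs_of_pos (Real.exp_pos _)]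
    calc _ ≤ Real.exp (-t * Λ n) * L * D * M := by gcongr
      _ = _ := by ring
  have hsg : Summable fun n => g n x := by
    refine Summable.of_norm_bounded (((hK t ht).1.mul_left (L * M * M / Λ 0))) fun n => ?_
    have hn := hpos n
    have h1 := hM.abs_le (mul_pos hn hx)
    have h2 := hM.abs_le (mul_pos hn hy)
    have h3 := hw n
    have h4 := hΛ.strictMono.monotone (Nat.zero_le n)
    rw [hg, Real.norm_eq_abs, abs_mul, abs_mul, abs_div, abs_mul, abs_of_pos (Real.exp_pos _),
      abs_of_pos hn]
    calc _ ≤ Real.exp (-t * Λ n) * L / Λ 0 * M * M := by gcongr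
      _ = _ := by ring
  have hmem : x ∈ Ioi (x / 2) := by
    rw [mem_Ioi]
    linarith
  have h := hasDerivAt_tsum_of_isPreconnected hub isOpen_Ioi (convex_Ioi (x / 2)).isPreconnected
    hderiv hbound hmem hsg hmem
  refine ⟨∑' n, g' n x, h.congr_of_eventuallyEq ?_, ?_⟩
  · filter_upwards [lt_mem_nhds hx] with r hr
    exact pKerL_eq hpos t hr hy
  · have hsg' : Summable fun n => g' n x := Summable.of_norm_bounded hub fun n => hbound n x hmem
    rw [pKerL_eq hpos t hx hy, ← tsum_neg, ← tsum_mul_left,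
      ← hsg'.neg.tsum_add (hsg.mul_left _)]
    refine tsum_congr fun n => ?_
    have hn := hpos n
    simp only [hg', hg, hdf]
    field_simp
    ring

lemma exists_abs_tsum_deltaL_le {ν : ℝ} (hν : -(1/2 : ℝ) < ν) {Λ : ℕ → ℝ}
    (hΛ : EnumeratesPositiveZeros (sqrtMulBesselJ ν) Λ) :
    ∃ C : ℝ, 0 < C ∧ ∀ t x y : ℝ, 0 < t → x ∈ Ioo (0 : ℝ) 1 → y ∈ Ioo (0 : ℝ) 1 →
      |∑' n, Real.exp (-t * Λ n) * zeroWeight ν Λ n * sqrtMulBesselJ (ν + 1) (Λ n * x) *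
          sqrtMulBesselJ ν (Λ n * y)| ≤ C / (t ^ 2 + |x - y| ^ 2) := by
  have hode := solvesBesselODE_sqrtMulBesselJ hν
  obtain ⟨M, hM, hM₁⟩ := exists_hasBVAmplitude_sqrtMulBesselJ hν
  obtain ⟨L, hL⟩ := exists_bvSeq_zeroWeight hν hΛ
  obtain ⟨s, hs, hsΛ⟩ := hode.exists_mul_le_zero hΛ
  obtain ⟨K, hK0, hK⟩ := exists_tsum_exp_le hs hsΛ
  obtain ⟨H, hH0, hH⟩ := hode.exists_sum_abs_zero_sub_le hΛ
  have hpos := hΛ.pos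
  have hL0 : 0 ≤ L := hL.nonneg
  have hM0 : 0 ≤ M := (abs_nonneg _).trans (hM.abs_le one_pos)
  set A : ℝ := L * M * M * K with hA
  set B : ℝ := 48 * (1 + 2 * H) * (2 * 1 * L) * M ^ 2 with hB
  have hA0 : 0 ≤ A := by positivity
  have hB0 : 0 ≤ B := by positivity
  refine ⟨A + B + 1, by positivity, fun t x y ht hx hy => ?_⟩
  set a : ℕ → ℝ := fun n => Real.exp (-t * Λ n) * zeroWeight ν Λ n *
    sqrtMulBesselJ (ν + 1) (Λ n * x) * sqrtMulBesselJ ν (Λ n * y) with ha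
  have hle (n : ℕ) : ‖a n‖ ≤ L * M * M * Real.exp (-t * Λ n) := by
    have h1 := hM₁.abs_le (mul_pos (hpos n) hx.1)
    have h2 := hM.abs_le (mul_pos (hpos n) hy.1)
    have h3 : |zeroWeight ν Λ n| ≤ L := by
      have := hL.1 n
      rwa [Complex.norm_real] at this
    rw [ha, Real.norm_eq_abs, abs_mul, abs_mul, abs_mul, abs_of_pos (Real.exp_pos _)]
    calc _ ≤ Real.exp (-t * Λ n) * L * M * M := by gcongr
      _ = _ := by ring
  obtain ⟨hE, hEK⟩ := hK t ht
  have hsum : Summable a := Summable.of_norm_bounded (hE.mul_left _) hle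
  have hfar : |∑' n, a n| * t ^ 2 ≤ A := by
    have h1 : |∑' n, a n| ≤ L * M * M * (K / t ^ 2) := by
      rw [← Real.norm_eq_abs]
      refine (tsum_of_norm_bounded (hE.mul_left (L * M * M)).hasSum hle).trans ?_
      rw [tsum_mul_left]
      gcongr
    calc _ ≤ L * M * M * (K / t ^ 2) * t ^ 2 := by gcongr
      _ = A := by
        rw [hA]
        field_simp
  have hnear : |∑' n, a n| * |x - y| ^ 2 ≤ B := by
    rcases eq_or_ne x y with hxy | hxy
    · simpa [hxy] using hB0
    · have hδ : 0 < |x - y| := abs_pos.2 (sub_ne_zero.2 hxy)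
      have hδ1 : |x - y| ≤ 1 := abs_le.2 ⟨by linarith [hx.1, hy.2], by linarith [hx.2, hy.1]⟩
      have hexp : BVSeq 1 fun n => ((Real.exp (-t * Λ n) : ℝ) : ℂ) := by
        have hanti : Antitone fun n => Real.exp (-t * Λ n) := by
          intro m n hmn
          have := hΛ.strictMono.monotone hmn
          simp only [Real.exp_le_exp]
          nlinarith
        have h := BVSeq.of_antitone hanti fun n => (Real.exp_pos _).le
        have h1 : Real.exp (-t * Λ 0) ≤ 1 := by
          rw [Real.exp_le_one_iff]
          nlinarith [hpos 0]
        exact ⟨fun n => (h.1 n).trans h1, fun N => (h.2 N).trans h1⟩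
      have hq := hexp.mul hL
      simp_rw [← Complex.ofReal_mul] at hq
      have hpart (N : ℕ) : |∑ k ∈ Finset.range N, a k| ≤ B / |x - y| :=
        abs_sum_mul_amplitudes_le hΛ.strictMono.monotone hpos hH hq hM₁ hM hx hy hxy N
      have hlim : |∑' n, a n| ≤ B / |x - y| :=
        le_of_tendsto hsum.hasSum.tendsto_sum_nat.abs (Eventually.of_forall hpart)
      rw [le_div_iff₀ hδ] at hlim
      calc |∑' n, a n| * |x - y| ^ 2 = |∑' n, a n| * |x - y| * |x - y| := by ring
        _ ≤ B * 1 := by gcongr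
        _ = B := mul_one B
  rw [le_div_iff₀ (by positivity)]
  linarith

/-- Estimate for `δ_L P_t(x,y)` (Lemma 2.4), together with its series reformulation. -/
theorem deltaL_poissonKernelL_estimate (ν : ℝ) (hν : -(1/2 : ℝ) < ν)
    (Λ : ℕ → ℝ) (hΛ : IsPositiveZerosOfBesselJ ν Λ) :
    ∃ C : ℝ, 0 < C ∧
      ∀ t x y : ℝ, 0 < t → x ∈ Ioo (0:ℝ) 1 → y ∈ Ioo (0:ℝ) 1 →
        (∃ d : ℝ, HasDerivAt (fun x' => pKerL ν Λ t x' y) d x ∧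
          |-d + ((ν + 1/2) / x) * pKerL ν Λ t x y| ≤ C / (t^2 + |x - y|^2)) ∧
        |∑' n : ℕ, Real.exp (-t * Λ n) * (Real.sqrt 2 / |Λ n * besselJ (ν + 1) (Λ n)|)^2 *
            (Λ n)^2 * Real.sqrt (x * y) * besselJ (ν + 1) (Λ n * x) * besselJ ν (Λ n * y)|
          ≤ C / (t^2 + |x - y|^2) := by
  have hz := enumeratesPositiveZeros_sqrtMulBesselJ hΛ
  obtain ⟨C, hC0, hC⟩ := exists_abs_tsum_deltaL_le hν hz
  refine ⟨C, hC0, fun t x y ht hx hy => ⟨?_, ?_⟩⟩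
  · obtain ⟨d, hd, hd'⟩ := hasDerivAt_pKerL hν hz ht hx.1 hy.1
    exact ⟨d, hd, hd' ▸ hC t x y ht hx hy⟩
  · rw [tsum_congr fun n => deltaL_term_eq t n (hz.pos n) hx.1]
    exact hC t x y ht hx hy
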